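/- For every integer n ≥ 2, the n-th higher topological complexity of the Klein bottle K equals 2n + 1, i.e., TC_n(K) = 2n + 1. -/

import Mathlib

open scoped unitInterval

noncomputable section

/-- Topology on the projectivization, as a quotient of the nonzero vectors. -/
instance projTop (K V : Type*) [DivisionRing K] [AddCommGroup V] [Module K V]
    [TopologicalSpace V] : TopologicalSpace (Projectivization K V) :=
  inferInstanceAs (TopologicalSpace (Quotient (projectivizationSetoid K V)))

/-- The real Milnor manifold `ℝH_{r,s}`, as the subspace of `ℝPʳ × ℝPˢ` of pairs
`([x], [y])` with `x₀y₀ + ⋯ + x_sy_s = 0` (for `s ≤ r`). -/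
def RealMilnor (r s : ℕ) :
    Set (Projectivization ℝ (Fin (r + 1) → ℝ) × Projectivization ℝ (Fin (s + 1) → ℝ)) :=
  {p | ∑ i : Fin (min (s + 1) (r + 1)),
      p.1.rep (Fin.castLE (min_le_right _ _) i) * p.2.rep (Fin.castLE (min_le_left _ _) i) = 0}

/-- The complex Milnor manifold `ℂH_{r,s}`, as the subspace of `ℂPʳ × ℂPˢ` of pairs
`([z], [w])` with `z₀w̄₀ + ⋯ + z_sw̄_s = 0` (for `s ≤ r`). -/
def ComplexMilnor (r s : ℕ) :
    Set (Projectivization ℂ (Fin (r + 1) → ℂ) × Projectivization ℂ (Fin (s + 1) → ℂ)) :=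
  {p | ∑ i : Fin (min (s + 1) (r + 1)),
      p.1.rep (Fin.castLE (min_le_right _ _) i) *
        (starRingEnd ℂ) (p.2.rep (Fin.castLE (min_le_left _ _) i)) = 0}

/-- The Lusternik–Schnirelmann category of `X`: the least number of open sets covering `X`,
each of whose inclusion into `X` is null-homotopic. -/
def lsCat (X : Type*) [TopologicalSpace X] : ℕ :=
  sInf {k | 0 < k ∧ ∃ U : Fin k → Set X,
    (∀ i, IsOpen (U i)) ∧ (⋃ i, U i) = Set.univ ∧
    ∀ i, ∃ x₀ : X, ∃ H : C(U i × I, X),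
      (∀ u : U i, H (u, 0) = (u : X)) ∧ (∀ u : U i, H (u, 1) = x₀)}

/-- The fibration `π_n : X^I → X^n`, evaluating a path at the times `i/(n-1)`,
`i = 0, …, n-1`. -/
def tcPi (X : Type*) [TopologicalSpace X] (n : ℕ) (γ : C(I, X)) : Fin n → X :=
  fun i => γ (Set.projIcc (0 : ℝ) 1 zero_le_one ((i : ℝ) / ((n : ℝ) - 1)))

/-- The `n`-th higher (sequential) topological complexity of `X`: the least number of open
sets covering `X^n`, each admitting a continuous local section of `π_n : X^I → X^n`. -/
def higherTC (X : Type*) [TopologicalSpace X] (n : ℕ) : ℕ :=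
  sInf {k | 0 < k ∧ ∃ U : Fin k → Set (Fin n → X),
    (∀ i, IsOpen (U i)) ∧ (⋃ i, U i) = Set.univ ∧
    ∀ i, ∃ sec : C(U i, C(I, X)), ∀ u : U i, tcPi X n (sec u) = (u : Fin n → X)}

/-- The `n`-th higher equivariant topological complexity of a `G`-space `X`:
the least number of `G`-invariant open sets covering `X^n` (with the diagonal action),
each admitting a `G`-equivariant map to `X^I` whose composite with `π_n` is
`G`-homotopic to the inclusion. -/
def eqHigherTC (G : Type*) [Group G] (X : Type*) [TopologicalSpace X] [MulAction G X]
    (n : ℕ) : ℕ :=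
  sInf {k | 0 < k ∧ ∃ U : Fin k → Set (Fin n → X),
    (∀ i, IsOpen (U i)) ∧ (⋃ i, U i) = Set.univ ∧
    (∀ i (g : G), ∀ v ∈ U i, g • v ∈ U i) ∧
    ∀ i, ∃ sec : C(U i, C(I, X)),
      (∀ (g : G) (v : U i) (hgv : g • (v : Fin n → X) ∈ U i) (t : I),
        (sec ⟨g • (v : Fin n → X), hgv⟩) t = g • (sec v) t) ∧
      ∃ H : C(U i × I, Fin n → X),
        (∀ v : U i, H (v, 0) = tcPi X n (sec v)) ∧
        (∀ v : U i, H (v, 1) = (v : Fin n → X)) ∧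
        (∀ (g : G) (v : U i) (hgv : g • (v : Fin n → X) ∈ U i) (t : I),
          H (⟨g • (v : Fin n → X), hgv⟩, t) = g • H (v, t))}

/-- `X` has covering dimension at most `m`: every finite open cover admits an open
refinement which still covers `X` and in which every point lies in at most `m + 1` sets. -/
def HasCovDimLE (X : Type*) [TopologicalSpace X] (m : ℕ) : Prop :=
  ∀ 𝒰 : Set (Set X), 𝒰.Finite → (∀ U ∈ 𝒰, IsOpen U) → ⋃₀ 𝒰 = Set.univ →
    ∃ 𝒱 : Set (Set X), (∀ V ∈ 𝒱, IsOpen V) ∧ ⋃₀ 𝒱 = Set.univ ∧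
      (∀ V ∈ 𝒱, ∃ U ∈ 𝒰, V ⊆ U) ∧
      ∀ x : X, {V ∈ 𝒱 | x ∈ V}.encard ≤ (m + 1 : ℕ)

/-- The covering dimension of `X`. -/
def covDim (X : Type*) [TopologicalSpace X] : ℕ :=
  sInf {m | HasCovDimLE X m}

end

namespace KleinTC


/-- Vertices of the triangulated flags. -/
def chainPt {ι : Type} {m : ℕ} (b : ι → ℤ) (ε : ι → ℤˣ) (e : ι ≃ Fin m) (k : ℕ) : ι → ℤ :=
  fun c => 2 * b c + if (e c : ℕ) < k then ((ε c : ℤˣ) : ℤ) else 0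

/-- Agreement of two sequences of vertices away from the index `l`. -/
def AgreeOff {V : Type} (m l : ℕ) (P P' : ℕ → V) : Prop :=
  ∀ k, k ≤ m → k ≠ l → P k = P' k

theorem zmod2_add_self (a : ZMod 2) : a + a = 0 := CharTwo.add_self_eq_zero a

theorem sum_mid {ι : Type} [Fintype ι] [DecidableEq ι] {m : ℕ} (F : (ℕ → ι → ℤ) → ZMod 2)
    (l : ℕ) (hl0 : 0 < l) (hlm : l < m)
    (hF : ∀ P P', AgreeOff m l P P' → F P = F P')
    (b : ι → ℤ) (ε : ι → ℤˣ) :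
    ∑ e : ι ≃ Fin m, F (chainPt b ε e) = 0 := by
  set s : Equiv.Perm (Fin m) := Equiv.swap ⟨l - 1, by omega⟩ ⟨l, hlm⟩ with hs
  refine Finset.sum_involution (fun e _ => e.trans s) ?_ ?_ ?_ ?_
  · intro e _
    have : F (chainPt b ε (e.trans s)) = F (chainPt b ε e) := by
      apply hF
      intro k _ hk
      funext c
      have : ((e.trans s) c : ℕ) < k ↔ (e c : ℕ) < k := by
        simp only [Equiv.trans_apply, hs]
        rw [Equiv.swap_apply_def]
        split_ifs with h1 h2
        · rw [h1]; simp only; omega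
        · rw [h2]; simp only; omega
        · rfl
      simp only [chainPt, this]
    rw [this, zmod2_add_self]
  · intro e _ _ h
    have := congrArg (fun f : ι ≃ Fin m => f (e.symm ⟨l, hlm⟩)) h
    simp only [Equiv.trans_apply, Equiv.apply_symm_apply, hs, Equiv.swap_apply_right] at this
    have := congrArg Fin.val this
    simp only at this
    omega
  · intro e _; simp
  · intro e _
    ext c
    simp [hs]

theorem sum_top {ι : Type} [Fintype ι] [DecidableEq ι] {m : ℕ} (F : (ℕ → ι → ℤ) → ZMod 2)
    (hm : 0 < m)
    (hF : ∀ P P', AgreeOff m m P P' → F P = F P')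
    (b : ι → ℤ) (e : ι ≃ Fin m) :
    ∑ ε : ι → ℤˣ, F (chainPt b ε e) = 0 := by
  set c : ι := e.symm ⟨m - 1, by omega⟩ with hc
  refine Finset.sum_involution (fun ε _ => Function.update ε c (- ε c)) ?_ ?_ ?_ ?_
  · intro ε _
    have : F (chainPt b (Function.update ε c (- ε c)) e) = F (chainPt b ε e) := by
      apply hF
      intro k hk hkm
      funext d
      by_cases hd : d = c
      · have : ¬ ((e d : ℕ) < k) := by
          rw [hd, hc]; simp; omega
        simp only [chainPt, this, if_false]
      · simp only [chainPt, Function.update_of_ne hd]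
    rw [this, zmod2_add_self]
  · intro ε _ _ h
    have := congrFun h c
    simp only [Function.update_self] at this
    rcases Int.units_eq_one_or (ε c) with h1 | h1 <;> rw [h1] at this <;> revert this <;> decide
  · intro e _; simp
  · intro ε _
    funext d
    by_cases hd : d = c
    · subst hd; simp
    · simp [Function.update_of_ne hd]

/-- The glide reflection on the vertices, in factor `j`. -/
def alphaV {n : ℕ} (M : ℕ) (j : Fin n) (v : Fin n × Bool → ℤ) : Fin n × Bool → ℤ :=
  fun c => if c = (j, false) then v c + 2 * M else if c = (j, true) then - v c else v c

/-- The translation on the vertices, in factor `j`. -/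
def betaV {n : ℕ} (M : ℕ) (j : Fin n) (v : Fin n × Bool → ℤ) : Fin n × Bool → ℤ :=
  fun c => if c = (j, true) then v c + 2 * M else v c

theorem inv_t {n m : ℕ} (M : ℕ) (F : (ℕ → (Fin n × Bool) → ℤ) → ZMod 2)
    (hb : ∀ j P, F (fun k => betaV M j (P k)) = F P) (j : Fin n) (e : Fin n × Bool ≃ Fin m)
    (B B' : Fin n × Bool → ℤ) (ε : Fin n × Bool → ℤˣ)
    (h : ∀ c, c ≠ (j, true) → B' c = B c) (q : ℤ) (hq : B' (j, true) = B (j, true) + M * q) :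
    F (chainPt B' ε e) = F (chainPt B ε e) := by
  have step : ∀ (B : Fin n × Bool → ℤ), 
      F (chainPt (Function.update B (j, true) (B (j, true) + M)) ε e) = F (chainPt B ε e) := by
    intro B
    rw [← hb j (chainPt B ε e)]
    congr 1
    funext k c
    by_cases hc : c = (j, true)
    · subst hc; simp [chainPt, betaV]; ring
    · simp [chainPt, betaV, hc]
  have key : ∀ (q : ℤ), F (chainPt (Function.update B (j, true) (B (j, true) + M * q)) ε e)
      = F (chainPt B ε e) := by
    intro q
    induction q using Int.induction_on with
    | zero => simp
    | succ i ih =>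
      rw [← ih, ← step (Function.update B (j, true) (B (j, true) + M * (i:ℤ)))]
      congr 2
      simp only [Function.update_self, Function.update_idem]
      congr 1; ring
    | pred i ih =>
      rw [← ih, ← step (Function.update B (j, true) (B (j, true) + M * (-(i:ℤ) - 1)))]
      congr 2
      simp only [Function.update_self, Function.update_idem]
      congr 1; ring
  rw [← key q]
  congr 2
  funext c
  by_cases hc : c = (j, true)
  · subst hc; simp [hq]
  · simp [hc, h c hc]

/-- flip of the signs at `c`. -/
def flipAt {ι : Type} [DecidableEq ι] (c : ι) (ε : ι → ℤˣ) : ι → ℤˣ :=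
  fun d => if d = c then - ε d else ε d

theorem inv_s {n m : ℕ} (M : ℕ) (F : (ℕ → (Fin n × Bool) → ℤ) → ZMod 2)
    (ha : ∀ j P, F (fun k => alphaV M j (P k)) = F P) (j : Fin n) (e : Fin n × Bool ≃ Fin m)
    (B B' : Fin n × Bool → ℤ) (ε : Fin n × Bool → ℤˣ)
    (h : ∀ c, c ≠ (j, true) → c ≠ (j, false) → B' c = B c)
    (ht : B' (j, true) = - B (j, true)) (hs : B' (j, false) = B (j, false) + M) :
    F (chainPt B' (flipAt (j, true) ε) e) = F (chainPt B ε e) := by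
  rw [← ha j (chainPt B ε e)]
  congr 1
  funext k c
  by_cases hc : c = (j, true)
  · subst hc
    simp only [chainPt, alphaV, flipAt, ht]
    simp
    split_ifs <;> ring
  · by_cases hc' : c = (j, false)
    · subst hc'
      simp [chainPt, alphaV, flipAt, hs]
      ring
    · simp [chainPt, alphaV, flipAt, hc, hc', h c hc hc']

theorem shift_eq {ι : Type} [DecidableEq ι] {m : ℕ} (F : (ℕ → ι → ℤ) → ZMod 2)
    (hF : ∀ P P', AgreeOff m 0 P P' → F P = F P') (e : ι ≃ Fin m) (c : ι) (hc : (e c : ℕ) = 0)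
    (B : ι → ℤ) (ε : ι → ℤˣ) :
    F (chainPt (Function.update B c (B c + (ε c : ℤ))) (flipAt c ε) e) = F (chainPt B ε e) := by
  apply hF
  intro k _ hk
  funext d
  by_cases hd : d = c
  · subst hd
    have : (e d : ℕ) < k := by omega
    simp [chainPt, flipAt, this]
    ring
  · simp [chainPt, flipAt, hd]

end KleinTC

namespace KleinTC

theorem flipAt_flipAt {ι : Type} [DecidableEq ι] (c : ι) (ε : ι → ℤˣ) :
    flipAt c (flipAt c ε) = ε := by
  funext d; simp only [flipAt]; split_ifs <;> simp

theorem flipAt_self {ι : Type} [DecidableEq ι] (c : ι) (ε : ι → ℤˣ) :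
    flipAt c ε c = - ε c := by simp [flipAt]

theorem unit_ne_neg (u : ℤˣ) : - u ≠ u := by
  rcases Int.units_eq_one_or u with h | h <;> rw [h] <;> decide

theorem flipAt_ne {ι : Type} [DecidableEq ι] (c : ι) (ε : ι → ℤˣ) : flipAt c ε ≠ ε := by
  intro h
  have := congrFun h c
  rw [flipAt_self] at this
  exact unit_ne_neg _ this

theorem zval_cast {M : ℕ} [NeZero M] (x : ZMod M) : (((x.val : ℕ) : ℤ) : ZMod M) = x := by
  simp

theorem val_shift {M : ℕ} [NeZero M] (x : ZMod M) (a : ℤ) :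
    ∃ q : ℤ, ((x + (a : ZMod M)).val : ℤ) = (x.val : ℤ) + a + M * q := by
  have : (((x + (a : ZMod M)).val : ℤ) : ZMod M) = (((x.val : ℤ) + a : ℤ) : ZMod M) := by
    rw [zval_cast]; push_cast; simp
  rw [ZMod.intCast_eq_intCast_iff_dvd_sub] at this
  obtain ⟨q, hq⟩ := this
  exact ⟨-q, by linarith [mul_neg (M:ℤ) q]⟩

theorem val_neg' {M : ℕ} [NeZero M] (x : ZMod M) :
    ∃ q : ℤ, ((-x).val : ℤ) = -(x.val : ℤ) + M * q := by
  have : (((-x).val : ℤ) : ZMod M) = ((-(x.val : ℤ) : ℤ) : ZMod M) := by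
    rw [zval_cast]; push_cast; simp
  rw [ZMod.intCast_eq_intCast_iff_dvd_sub] at this
  obtain ⟨q, hq⟩ := this
  exact ⟨-q, by linarith [mul_neg (M:ℤ) q]⟩

theorem val_shift_unit {M : ℕ} [NeZero M] (x : ZMod M) (u : ℤˣ) :
    ((x + ((u : ℤ) : ZMod M)).val : ℤ) = (x.val : ℤ) + u ∨
    ((x + ((u : ℤ) : ZMod M)).val : ℤ) = (x.val : ℤ) + u - u * M := by
  obtain ⟨q, hq⟩ := val_shift x (u : ℤ)
  have h1 := ZMod.val_lt x
  have h2 := ZMod.val_lt (x + ((u : ℤ) : ZMod M))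
  have hM : 0 < M := Nat.pos_of_ne_zero (NeZero.ne M)
  have h3 : (0:ℤ) ≤ (x.val : ℤ) := by positivity
  have h4 : (0:ℤ) ≤ ((x + ((u : ℤ) : ZMod M)).val : ℤ) := by positivity
  zify at h1 h2 hM
  rcases Int.units_eq_one_or u with h | h
  · subst h
    simp only [Units.val_one] at *
    have : q ≤ 0 := by by_contra hc; nlinarith
    have : -1 ≤ q := by by_contra hc; nlinarith
    have : q = 0 ∨ q = -1 := by omega
    rcases this with h | h <;> subst h
    · left; linarith
    · right; linarith
  · subst h
    simp only [Units.val_neg, Units.val_one] at *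
    have : q ≤ 1 := by by_contra hc; nlinarith
    have : 0 ≤ q := by by_contra hc; nlinarith
    have : q = 0 ∨ q = 1 := by omega
    rcases this with h | h <;> subst h
    · left; linarith
    · right; linarith

/-- Integer representatives. -/
def lft {ι : Type} {M : ℕ} (b : ι → ZMod M) : ι → ℤ := fun c => ((b c).val : ℤ)

theorem sum_bot_t {n m : ℕ} (M : ℕ) [NeZero M] (F : (ℕ → (Fin n × Bool) → ℤ) → ZMod 2)
    (hb : ∀ j P, F (fun k => betaV M j (P k)) = F P)
    (hF : ∀ P P', AgreeOff m 0 P P' → F P = F P') (e : Fin n × Bool ≃ Fin m)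
    (j : Fin n) (hc : (e (j, true) : ℕ) = 0) :
    ∑ x : (Fin n × Bool → ZMod M) × (Fin n × Bool → ℤˣ), F (chainPt (lft x.1) x.2 e) = 0 := by
  refine Finset.sum_involution (fun x _ => (Function.update x.1 (j, true)
    (x.1 (j, true) + ((x.2 (j, true) : ℤ) : ZMod M)), flipAt (j, true) x.2)) ?_ ?_ ?_ ?_
  · rintro ⟨b, ε⟩ _
    simp only
    rw [← shift_eq F hF e _ hc (lft b) ε]
    obtain ⟨q, hq⟩ := val_shift (b (j, true)) (ε (j, true))
    rw [inv_t M F hb j e (Function.update (lft b) (j, true) (lft b (j, true) + (ε (j, true) : ℤ)))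
      (lft (Function.update b (j, true) (b (j, true) + ((ε (j, true) : ℤ) : ZMod M)))) _ ?_ q ?_]
    · exact zmod2_add_self _
    · intro c hc; simp [lft, hc]
    · simp only [lft, Function.update_self]; exact hq
  · rintro ⟨b, ε⟩ _ _ h
    exact flipAt_ne _ _ (congrArg Prod.snd h)
  · intros; simp
  · rintro ⟨b, ε⟩ _
    simp [flipAt_flipAt, flipAt_self]

/-- The involution for glide coordinates. -/
def botS {n : ℕ} {M : ℕ} [NeZero M] (j : Fin n)
    (x : (Fin n × Bool → ZMod M) × (Fin n × Bool → ℤˣ)) :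
    (Fin n × Bool → ZMod M) × (Fin n × Bool → ℤˣ) :=
  let c : Fin n × Bool := (j, false)
  let y := x.1 c + ((x.2 c : ℤ) : ZMod M)
  if (y.val : ℤ) = ((x.1 c).val : ℤ) + x.2 c then
    (Function.update x.1 c y, flipAt c x.2)
  else
    (Function.update (Function.update x.1 c y) (j, true) (- x.1 (j, true)),
      flipAt (j, true) (flipAt c x.2))

theorem flipAt_comm {ι : Type} [DecidableEq ι] (c d : ι) (ε : ι → ℤˣ) :
    flipAt c (flipAt d ε) = flipAt d (flipAt c ε) := by
  funext x; simp only [flipAt]; split_ifs <;> simp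

theorem sum_bot_s {n m : ℕ} (M : ℕ) [NeZero M] (F : (ℕ → (Fin n × Bool) → ℤ) → ZMod 2)
    (ha : ∀ j P, F (fun k => alphaV M j (P k)) = F P)
    (hb : ∀ j P, F (fun k => betaV M j (P k)) = F P)
    (hF : ∀ P P', AgreeOff m 0 P P' → F P = F P') (e : Fin n × Bool ≃ Fin m)
    (j : Fin n) (hc : (e (j, false) : ℕ) = 0) :
    ∑ x : (Fin n × Bool → ZMod M) × (Fin n × Bool → ℤˣ), F (chainPt (lft x.1) x.2 e) = 0 := by
  refine Finset.sum_involution (fun x _ => botS j x) ?_ ?_ ?_ ?_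
  · rintro ⟨b, ε⟩ _
    simp only [botS]
    rw [← shift_eq F hF e _ hc (lft b) ε]
    split_ifs with hw
    · simp only
      have : lft (Function.update b (j, false) (b (j, false) + ((ε (j, false) : ℤ) : ZMod M))) =
          Function.update (lft b) (j, false) (lft b (j, false) + (ε (j, false) : ℤ)) := by
        funext c
        by_cases hc : c = (j, false)
        · subst hc; simp only [lft, Function.update_self]; exact hw
        · simp [lft, hc]
      rw [this]; exact zmod2_add_self _
    · simp only
      have hv := (val_shift_unit (b (j, false)) (ε (j, false))).resolve_left hw
      obtain ⟨q, hq⟩ := val_neg' (b (j, true))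
      set y := b (j, false) + ((ε (j, false) : ℤ) : ZMod M) with hy
      set b' := Function.update (Function.update b (j, false) y) (j, true) (- b (j, true)) with hb'
      have hbf : lft b' (j, false) = (y.val : ℤ) := by
        simp only [lft, hb']
        rw [Function.update_of_ne (by simp), Function.update_self]
      have e1 : F (chainPt (lft b') (flipAt (j, true) (flipAt (j, false) ε)) e) =
          F (chainPt (Function.update (lft b') (j, true) (- lft b (j, true)))
            (flipAt (j, true) (flipAt (j, false) ε)) e) := by
        apply inv_t M F hb j e _ _ _ _ q
        · simp only [lft, hb', Function.update_self]; exact hq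
        · intro c hc; simp [hc]
      rw [e1]
      have e2 : F (chainPt (Function.update (lft b') (j, true) (- lft b (j, true)))
            (flipAt (j, true) (flipAt (j, false) ε)) e) =
          F (chainPt (Function.update (lft b) (j, false) (lft b (j, false) + (ε (j, false) : ℤ)))
            (flipAt (j, false) ε) e) := by
        rcases Int.units_eq_one_or (ε (j, false)) with h | h
        · rw [← inv_s M F ha j e (Function.update (lft b') (j, true) (- lft b (j, true)))
            (Function.update (lft b) (j, false) (lft b (j, false) + (ε (j, false) : ℤ)))
            (flipAt (j, true) (flipAt (j, false) ε)) ?_ ?_ ?_, flipAt_flipAt]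
          · intro c h1 h2
            simp [h1, h2, lft, hb']
          · simp
          · rw [Function.update_self, Function.update_of_ne (by simp), hbf, hv, h]
            simp only [Units.val_one, Units.val_neg, lft]
            ring
        · apply inv_s M F ha j e
          · intro c h1 h2
            simp [h1, h2, lft, hb']
          · simp
          · rw [Function.update_self, Function.update_of_ne (by simp), hbf, hv, h]
            simp only [Units.val_one, Units.val_neg, lft]
            ring
      rw [e2]; exact zmod2_add_self _
  · rintro ⟨b, ε⟩ _ _ h
    have := congrFun (congrArg Prod.snd h) (j, false)
    simp only [botS] at this
    split_ifs at this
    · exact unit_ne_neg _ ((flipAt_self _ _).symm.trans this)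
    · simp [flipAt] at this
  · intros; simp
  · rintro ⟨b, ε⟩ _
    simp only [botS]
    set y := b (j, false) + ((ε (j, false) : ℤ) : ZMod M) with hy
    have hyy : y + ((-(ε (j, false)) : ℤ) : ZMod M) = b (j, false) := by rw [hy]; push_cast; ring
    have hyy' : y + -((ε (j, false) : ℤ) : ZMod M) = b (j, false) := by rw [hy]; ring
    split_ifs with hw hw2 hw2
    · simp [flipAt_self, hyy', flipAt_flipAt]
    · exfalso
      apply hw2
      simp only [Function.update_self, flipAt_self, Units.val_neg, hyy]
      linarith
    · exfalso
      apply hw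
      rw [flipAt_comm (j, true) (j, false)] at hw2
      simp only [flipAt_self] at hw2
      rw [Function.update_of_ne (by simp), Function.update_self] at hw2
      simp only [flipAt, Prod.mk.injEq, Bool.false_eq_true, and_false, if_false,
        Units.val_neg, hyy] at hw2
      linarith
    · clear hw2
      refine Prod.ext ?_ ?_
      · funext c
        by_cases h1 : c = (j, true)
        · subst h1; simp
        · by_cases h2 : c = (j, false)
          · subst h2; simp [hyy', flipAt]
          · simp [h1, h2]
      · rw [flipAt_comm (j, true) (j, false) ε, flipAt_flipAt (j, false), flipAt_flipAt] 

/-- The total sum over all flags of the fundamental domain. -/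
def tot {n m : ℕ} (M : ℕ) [NeZero M] (F : (ℕ → (Fin n × Bool) → ℤ) → ZMod 2) : ZMod 2 :=
  ∑ e : Fin n × Bool ≃ Fin m, ∑ x : (Fin n × Bool → ZMod M) × (Fin n × Bool → ℤˣ),
    F (chainPt (lft x.1) x.2 e)

theorem tot_eq_zero {n m : ℕ} (M : ℕ) [NeZero M] (F : (ℕ → (Fin n × Bool) → ℤ) → ZMod 2)
    (ha : ∀ j P, F (fun k => alphaV M j (P k)) = F P)
    (hb : ∀ j P, F (fun k => betaV M j (P k)) = F P) (hm : 0 < m) (l : ℕ) (hl : l ≤ m)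
    (hF : ∀ P P', AgreeOff m l P P' → F P = F P') : tot (m := m) M F = 0 := by
  unfold tot
  rcases Nat.eq_zero_or_pos l with h0 | h0
  · subst h0
    apply Finset.sum_eq_zero
    intro e _
    obtain ⟨⟨j, x⟩, hx⟩ : ∃ c, (e c : ℕ) = 0 := ⟨e.symm ⟨0, hm⟩, by simp⟩
    cases x
    · exact sum_bot_s M F ha hb hF e j hx
    · exact sum_bot_t M F hb hF e j hx
  · rcases hl.lt_or_eq with h1 | h1
    · rw [Finset.sum_comm]
      apply Finset.sum_eq_zero
      intro x _
      exact sum_mid F l h0 h1 hF _ _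
    · subst h1
      apply Finset.sum_eq_zero
      intro e _
      rw [Fintype.sum_prod_type]
      apply Finset.sum_eq_zero
      intro b _
      exact sum_top F hm hF (lft b) e

end KleinTC

namespace KleinTC

/-- Abstract data for the cochain-level cup product. -/
structure CupData (V A Γ : Type) [AddCommGroup A] (m : ℕ) where
  T : ((ℕ → V) → ZMod 2) → ZMod 2
  T_add : ∀ F G, T (F + G) = T F + T G
  act : Γ → V → V
  L : Γ → A →+ A
  Ψ : (ℕ → A) → ZMod 2
  Ψ_add : ∀ (v : ℕ → A) i a b, i < m →
    Ψ (Function.update v i (a + b)) = Ψ (Function.update v i a) + Ψ (Function.update v i b)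
  Ψ_congr : ∀ v w : ℕ → A, (∀ k, k < m → v k = w k) → Ψ v = Ψ w
  Ψ_L : ∀ γ v, Ψ (fun k => L γ (v k)) = Ψ v
  T_zero : ∀ F, (∀ γ P, F (fun k => act γ (P k)) = F P) →
    (∃ l, l ≤ m ∧ ∀ P P', AgreeOff m l P P' → F P = F P') → T F = 0

namespace CupData

variable {V A Γ : Type} [AddCommGroup A] {m : ℕ} (S : CupData V A Γ m)

/-- Affine equivariance of labels. -/
def Equi (c : Γ → A) (x : V → A) : Prop := ∀ γ v, x (S.act γ v) = S.L γ (x v) + c γ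

/-- Linear equivariance of a slot functional. -/
def Slot (φ : (ℕ → V) → A) : Prop := ∀ γ P, φ (fun k => S.act γ (P k)) = S.L γ (φ P)

/-- Evaluation. -/
def G (φ : ℕ → (ℕ → V) → A) : (ℕ → V) → ZMod 2 := fun P => S.Ψ (fun k => φ k P)

/-- coboundary slot. -/
def D (x : V → A) (a b : ℕ) : (ℕ → V) → A := fun P => x (P b) - x (P a)

theorem slot_D {c : Γ → A} {x : V → A} (hx : S.Equi c x) (a b : ℕ) : S.Slot (D x a b) := by
  intro γ P
  simp only [D, hx γ, map_sub]; abel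

theorem slot_sub {c : Γ → A} {x x' : V → A} (hx : S.Equi c x) (hx' : S.Equi c x') (a : ℕ) :
    S.Slot (fun P => x (P a) - x' (P a)) := by
  intro γ P
  simp only [hx γ, hx' γ, map_sub]; abel

theorem G_inv {φ : ℕ → (ℕ → V) → A} (hφ : ∀ k, S.Slot (φ k)) (γ : Γ) (P : ℕ → V) :
    S.G φ (fun k => S.act γ (P k)) = S.G φ P := by
  simp only [G]
  rw [← S.Ψ_L γ (fun k => φ k P)]
  congr 1; funext k; exact hφ k γ P

theorem T_G_zero {φ : ℕ → (ℕ → V) → A} (hφ : ∀ k, S.Slot (φ k)) (l : ℕ) (hl : l ≤ m)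
    (h : ∀ k, k < m → ∀ P P', AgreeOff m l P P' → φ k P = φ k P') : S.T (S.G φ) = 0 :=
  S.T_zero _ (S.G_inv hφ) ⟨l, hl, fun P P' hP => S.Ψ_congr _ _ fun k hk => h k hk P P' hP⟩

theorem G_add (φ φ' φ'' : ℕ → (ℕ → V) → A) (i : ℕ) (hi : i < m)
    (h1 : ∀ k, k < m → k ≠ i → φ' k = φ k) (h2 : ∀ k, k < m → k ≠ i → φ'' k = φ k)
    (h3 : ∀ P, φ i P = φ' i P + φ'' i P) : S.G φ = S.G φ' + S.G φ'' := by
  funext P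
  have e0 : S.G φ P = S.Ψ (Function.update (fun k => φ k P) i (φ' i P + φ'' i P)) := by
    apply S.Ψ_congr
    intro k _
    by_cases hk : k = i
    · subst hk; simp [h3]
    · simp [hk]
  have e1 : S.G φ' P = S.Ψ (Function.update (fun k => φ k P) i (φ' i P)) := by
    apply S.Ψ_congr
    intro k hkm
    by_cases hk : k = i
    · subst hk; simp
    · simp [hk, h1 k hkm hk]
  have e2 : S.G φ'' P = S.Ψ (Function.update (fun k => φ k P) i (φ'' i P)) := by
    apply S.Ψ_congr
    intro k hkm
    by_cases hk : k = i
    · subst hk; simp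
    · simp [hk, h2 k hkm hk]
  rw [Pi.add_apply, e0, e1, e2, S.Ψ_add _ _ _ _ hi]

theorem zmod2_eq_of_add {a b : ZMod 2} (h : a + b = 0) : a = b := by
  revert a b; decide

theorem part_up {c : ℕ → Γ → A} {x : ℕ → V → A} (hx : ∀ k, S.Equi (c k) (x k)) (g : V → A)
    (i : ℕ) (hi : i < m) (hg : S.Slot (fun P => g (P (i + 1)))) :
    S.T (S.G (fun k => if k = i then fun P => g (P (i + 1)) else D (x k) k (k + 1))) = 0 := by
  let C : ℕ → ℕ → (ℕ → V) → A := fun l k =>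
    if k = i then fun P => g (P (i + 1)) else
      if l ≤ k ∧ k < i then D (x k) (k + 1) (k + 2) else D (x k) k (k + 1)
  have hC : ∀ l k, S.Slot (C l k) := by
    intro l k
    simp only [C]
    split_ifs
    · exact hg
    · exact S.slot_D (hx k) _ _
    · exact S.slot_D (hx k) _ _
  have key : ∀ l, l ≤ i → S.T (S.G (C l)) = 0 := by
    intro l
    induction l with
    | zero =>
      intro _
      apply S.T_G_zero (hC 0) 0 (by omega)
      intro k hk P P' hP
      simp only [C]
      split_ifs with h1 h2
      · simp only [hP (i + 1) (by omega) (by omega)]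
      · simp only [D, hP (k + 1) (by omega) (by omega), hP (k + 2) (by omega) (by omega)]
      · simp only [D, hP (k + 1) (by omega) (by omega), hP (k) (by omega) (by omega)]
    | succ l ih =>
      intro hl
      have ih' := ih (by omega)
      let φ : ℕ → (ℕ → V) → A := fun k => if k = l then D (x l) l (l + 2) else C l k
      have hsum : S.G φ = S.G (C (l + 1)) + S.G (C l) := by
        apply S.G_add _ _ _ l (by omega)
        · intro k hk hkl
          simp only [φ, C, hkl, if_false]
          by_cases h1 : k = i
          · simp [h1]
          · simp only [h1, if_false]
            have : (l + 1 ≤ k ∧ k < i) ↔ (l ≤ k ∧ k < i) := by omega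
            simp only [this]
        · intro k hk hkl
          simp only [φ, hkl, if_false]
        · intro P
          have h1 : l ≠ i := by omega
          have h2 : ¬ (l + 1 ≤ l ∧ l < i) := by omega
          have h3 : (l ≤ l ∧ l < i) := by omega
          simp only [φ, C, if_true, if_neg h1]
          rw [if_neg h2, if_pos h3]
          simp only [D]
          abel
      have hz : S.T (S.G φ) = 0 := by
        apply S.T_G_zero _ (l + 1) (by omega)
        · intro k hk P P' hP
          simp only [φ, C]
          split_ifs with h0 h1 h2
          · simp only [D, hP (l + 2) (by omega) (by omega), hP (l) (by omega) (by omega)]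
          · simp only [hP (i + 1) (by omega) (by omega)]
          · simp only [D, hP (k + 1) (by omega) (by omega), hP (k + 2) (by omega) (by omega)]
          · simp only [D, hP (k + 1) (by omega) (by omega), hP (k) (by omega) (by omega)]
        · intro k
          simp only [φ]
          split_ifs
          · exact S.slot_D (hx l) _ _
          · exact hC l k
      rw [hsum, S.T_add, ih', add_zero] at hz
      exact hz
  have := key i le_rfl
  convert this using 3
  funext k
  simp only [C]
  have : ¬ (i ≤ k ∧ k < i) := by omega
  simp only [this, if_false]

theorem part_down {c : ℕ → Γ → A} {x : ℕ → V → A} (hx : ∀ k, S.Equi (c k) (x k)) (g : V → A)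
    (i : ℕ) (hi : i < m) (hg : S.Slot (fun P => g (P i))) :
    S.T (S.G (fun k => if k = i then fun P => g (P i) else D (x k) k (k + 1))) = 0 := by
  let C : ℕ → ℕ → (ℕ → V) → A := fun l k =>
    if k = i then fun P => g (P i) else
      if i < k ∧ k < l then D (x k) (k - 1) k else D (x k) k (k + 1)
  have hC : ∀ l k, S.Slot (C l k) := by
    intro l k
    simp only [C]
    split_ifs
    · exact hg
    · exact S.slot_D (hx k) _ _
    · exact S.slot_D (hx k) _ _
  have key : ∀ q l, l + q = m → i < l → S.T (S.G (C l)) = 0 := by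
    intro q
    induction q with
    | zero =>
      intro l hl hil
      apply S.T_G_zero (hC l) m (by omega)
      intro k hk P P' hP
      simp only [C]
      split_ifs with h1 h2
      · simp only [hP i (by omega) (by omega)]
      · simp only [D, hP (k - 1) (by omega) (by omega), hP k (by omega) (by omega)]
      · simp only [D, hP (k + 1) (by omega) (by omega), hP (k) (by omega) (by omega)]
    | succ q ih =>
      intro l hl hil
      have ih' := ih (l + 1) (by omega) (by omega)
      let φ : ℕ → (ℕ → V) → A := fun k => if k = l then D (x l) (l - 1) (l + 1) else C l k
      have hsum : S.G φ = S.G (C (l + 1)) + S.G (C l) := by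
        apply S.G_add _ _ _ l (by omega)
        · intro k hk hkl
          simp only [φ, C, hkl, if_false]
          by_cases h1 : k = i
          · simp [h1]
          · simp only [h1, if_false]
            have : (i < k ∧ k < l + 1) ↔ (i < k ∧ k < l) := by omega
            simp only [this]
        · intro k hk hkl
          simp only [φ, hkl, if_false]
        · intro P
          have h1 : l ≠ i := by omega
          have h2 : (i < l ∧ l < l + 1) := by omega
          have h3 : ¬ (i < l ∧ l < l) := by omega
          simp only [φ, C, if_true, if_neg h1]
          rw [if_neg h3, if_pos h2]
          simp only [D]
          abel
      have hz : S.T (S.G φ) = 0 := by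
        apply S.T_G_zero _ l (by omega)
        · intro k hk P P' hP
          simp only [φ, C]
          split_ifs with h0 h1 h2
          · simp only [D, hP (l + 1) (by omega) (by omega), hP (l - 1) (by omega) (by omega)]
          · simp only [hP i (by omega) (by omega)]
          · simp only [D, hP (k - 1) (by omega) (by omega), hP k (by omega) (by omega)]
          · simp only [D, hP (k + 1) (by omega) (by omega), hP (k) (by omega) (by omega)]
        · intro k
          simp only [φ]
          split_ifs
          · exact S.slot_D (hx l) _ _
          · exact hC l k
      rw [hsum, S.T_add, ih', zero_add] at hz
      exact hz
  have := key (m - (i + 1)) (i + 1) (by omega) (by omega)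
  convert this using 3
  funext k
  simp only [C]
  have : ¬ (i < k ∧ k < i + 1) := by omega
  simp only [this, if_false]

/-- The total value of a family of labels. -/
def val (x : ℕ → V → A) : ZMod 2 := S.T (S.G (fun k => D (x k) k (k + 1)))

theorem val_congr (x y : ℕ → V → A) (h : ∀ k, k < m → x k = y k) : S.val x = S.val y := by
  unfold val
  congr 1
  funext P
  apply S.Ψ_congr
  intro k hk
  simp only [h k hk]

theorem val_one {c : ℕ → Γ → A} {x y : ℕ → V → A} (hx : ∀ k, S.Equi (c k) (x k))
    (hy : ∀ k, S.Equi (c k) (y k)) (i : ℕ) (h : ∀ k, k ≠ i → y k = x k) : S.val y = S.val x := by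
  by_cases hi : i < m
  swap
  · apply S.val_congr; intro k hk; exact h k (by omega)
  let g : V → A := fun v => y i v - x i v
  have h1 := S.part_up hx g i hi (S.slot_sub (hy i) (hx i) _)
  have h2 := S.part_down hx (fun v => - g v) i hi (by
    intro γ P
    have := S.slot_sub (hy i) (hx i) i γ P
    simp only [g, map_neg] at this ⊢
    rw [this])
  let φ : ℕ → (ℕ → V) → A := fun k => if k = i then fun P => g (P (i + 1)) + (- g (P i))
    else D (x k) k (k + 1)
  have h3 : S.T (S.G φ) = 0 := by
    rw [S.G_add (φ := φ) (i := i) (hi := hi) (φ' := fun k => if k = i then fun P => g (P (i + 1))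
        else D (x k) k (k + 1)) (φ'' := fun k => if k = i then fun P => - g (P i)
        else D (x k) k (k + 1)), S.T_add, h1, h2, add_zero]
    · intro k _ hk; simp [φ, hk]
    · intro k _ hk; simp [φ, hk]
    · intro P; simp [φ]
  unfold val
  rw [S.G_add (fun k => D (y k) k (k + 1)) φ (fun k => D (x k) k (k + 1)) i hi, S.T_add, h3,
    zero_add]
  · intro k _ hk; simp [φ, hk, h k hk]
  · intro k _ hk; simp [h k hk]
  · intro P
    simp only [φ, if_true, D, g]; abel

theorem val_eq {c : ℕ → Γ → A} {x y : ℕ → V → A} (hx : ∀ k, S.Equi (c k) (x k))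
    (hy : ∀ k, S.Equi (c k) (y k)) : S.val y = S.val x := by
  have key : ∀ r, S.val (fun k => if k < r then y k else x k) = S.val x := by
    intro r
    induction r with
    | zero => simp
    | succ r ih =>
      rw [← ih]
      apply S.val_one (c := c) (i := r)
      · intro k; split_ifs
        · exact hy k
        · exact hx k
      · intro k; split_ifs
        · exact hy k
        · exact hx k
      · intro k hk
        have : k < r + 1 ↔ k < r := by omega
        simp only [this]
  rw [← key m]
  apply S.val_congr
  intro k hk
  simp [hk]

end CupData
end KleinTC

namespace KleinTC

/-- The sign `(-1)^i`. -/
def sg (i : ℤ) : ℤ := if i % 2 = 0 then 1 else -1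

theorem sg_even {i : ℤ} (h : i % 2 = 0) : sg i = 1 := by simp [sg, h]
theorem sg_odd {i : ℤ} (h : i % 2 = 1) : sg i = -1 := by simp [sg, h]

theorem sg_cases (i : ℤ) : (i % 2 = 0 ∧ sg i = 1) ∨ (i % 2 = 1 ∧ sg i = -1) := by
  rcases Int.emod_two_eq_zero_or_one i with h | h
  · left; exact ⟨h, sg_even h⟩
  · right; exact ⟨h, sg_odd h⟩

theorem sg_add (i j : ℤ) : sg (i + j) = sg i * sg j := by
  rcases sg_cases i with ⟨h, h'⟩ | ⟨h, h'⟩ <;> rcases sg_cases j with ⟨k, k'⟩ | ⟨k, k'⟩ <;>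
    rw [h', k']
  · rw [sg_even (by omega)]; rfl
  · rw [sg_odd (by omega)]; rfl
  · rw [sg_odd (by omega)]; rfl
  · rw [sg_even (by omega)]; rfl

theorem sg_neg (i : ℤ) : sg (-i) = sg i := by
  rcases sg_cases i with ⟨h, h'⟩ | ⟨h, h'⟩ <;> rw [h']
  · rw [sg_even (by omega)]
  · rw [sg_odd (by omega)]

theorem sg_zero : sg 0 = 1 := rfl
theorem sg_one : sg 1 = -1 := rfl

theorem sg_sub (i j : ℤ) : sg (i - j) = sg i * sg j := by
  rw [sub_eq_add_neg, sg_add, sg_neg]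

theorem sg_mul_self (i : ℤ) : sg i * sg i = 1 := by
  rcases sg_cases i with ⟨h, h'⟩ | ⟨h, h'⟩ <;> rw [h'] <;> rfl

/-- left multiplication by the glide reflection -/
def lA (g : ℤ × ℤ) : ℤ × ℤ := (g.1 + 1, g.2)
/-- left multiplication by the translation -/
def lB (g : ℤ × ℤ) : ℤ × ℤ := (g.1, g.2 + sg g.1)
/-- right multiplication by the inverse glide reflection -/
def rA (g : ℤ × ℤ) : ℤ × ℤ := (g.1 - 1, - g.2)
/-- right multiplication by the inverse translation -/
def rB (g : ℤ × ℤ) : ℤ × ℤ := (g.1, g.2 - 1)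

/-- Equivariance for group valued labels. -/
structure GEqui {n : ℕ} (M : ℕ) (g : (Fin n × Bool → ℤ) → Fin n → ℤ × ℤ) : Prop where
  zero : ∀ v (j : Fin n), (j : ℕ) = 0 → g v j = (0, 0)
  alpha : ∀ v j l, g (alphaV M j v) l =
    (if l = j then rA else id) ((if (j : ℕ) = 0 then lA else id) (g v l))
  beta : ∀ v j l, g (betaV M j v) l =
    (if l = j then rB else id) ((if (j : ℕ) = 0 then lB else id) (g v l))

/-- label of a group element -/
def lab (g : ℤ × ℤ) : Fin 3 → ZMod 2 := ![(g.2 : ZMod 2), ((g.1 + g.2 : ℤ) : ZMod 2),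
  ((g.2 / 2 : ℤ) : ZMod 2)]

theorem cast_eq_of_emod {a b : ℤ} (h : a % 2 = b % 2) : (a : ZMod 2) = (b : ZMod 2) := by
  rw [ZMod.intCast_eq_intCast_iff]; exact h

/-- linear part -/
def lin (p q : ZMod 2) : (Fin 3 → ZMod 2) →+ (Fin 3 → ZMod 2) where
  toFun v := ![v 0, v 1, v 2 + p * v 0 + q * v 1]
  map_zero' := by ext i; fin_cases i <;> simp
  map_add' v w := by ext i; fin_cases i <;> simp; ring

theorem lin_zero (v : Fin 3 → ZMod 2) : lin 0 0 v = v := by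
  ext i; fin_cases i <;> simp [lin]

theorem lab_lA (g : ℤ × ℤ) : lab (lA g) = lin 0 0 (lab g) + ![0, 1, 0] := by
  rw [lin_zero]
  ext i; fin_cases i <;> simp [lab, lA]; ring

theorem lab_rA (g : ℤ × ℤ) : lab (rA g) = lin 1 0 (lab g) + ![0, 1, 0] := by
  ext i; fin_cases i
  · simp [lab, rA, lin]
  · simp only [lab, rA, lin]; simp
    rw [sub_eq_add_neg]; simp
    ring
  · simp only [lab, rA, lin]; simp
    rw [← Int.cast_add]
    apply cast_eq_of_emod
    have h4 : g.2 % 4 = 0 ∨ g.2 % 4 = 1 ∨ g.2 % 4 = 2 ∨ g.2 % 4 = 3 := by omega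
    rcases h4 with h4 | h4 | h4 | h4 <;> omega

theorem lab_rB (g : ℤ × ℤ) : lab (rB g) = lin 1 0 (lab g) + ![1, 1, 1] := by
  ext i; fin_cases i
  · simp [lab, rB, lin]
    rw [sub_eq_add_neg]; simp
  · simp only [lab, rB, lin]; simp
    rw [sub_eq_add_neg]; simp
    ring
  · simp only [lab, rB, lin]; simp
    rw [show ((g.2 / 2 : ℤ) : ZMod 2) + (g.2 : ZMod 2) + 1 = ((g.2 / 2 + g.2 + 1 : ℤ) : ZMod 2) by
      push_cast; ring]
    apply cast_eq_of_emod
    have h4 : g.2 % 4 = 0 ∨ g.2 % 4 = 1 ∨ g.2 % 4 = 2 ∨ g.2 % 4 = 3 := by omega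
    rcases h4 with h4 | h4 | h4 | h4 <;> omega

theorem lab_lB (g : ℤ × ℤ) : lab (lB g) = lin 0 1 (lab g) + ![1, 1, 0] := by
  ext i; fin_cases i
  · simp only [lab, lB, lin]; simp
    rw [← Int.cast_one]
    apply cast_eq_of_emod
    rcases sg_cases g.1 with ⟨h, h'⟩ | ⟨h, h'⟩ <;> rw [h'] <;> omega
  · simp only [lab, lB, lin]; simp
    rw [← Int.cast_one, ← Int.cast_add, ← Int.cast_add, ← Int.cast_add, ← Int.cast_add]
    apply cast_eq_of_emod
    rcases sg_cases g.1 with ⟨h, h'⟩ | ⟨h, h'⟩ <;> rw [h'] <;> omega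
  · simp only [lab, lB, lin]; simp
    rw [← Int.cast_add, ← Int.cast_add]
    apply cast_eq_of_emod
    have h4 : g.2 % 4 = 0 ∨ g.2 % 4 = 1 ∨ g.2 % 4 = 2 ∨ g.2 % 4 = 3 := by omega
    rcases sg_cases g.1 with ⟨h, h'⟩ | ⟨h, h'⟩ <;> rw [h'] <;>
      rcases h4 with h4 | h4 | h4 | h4 <;> omega

/-- The determinant in characteristic two. -/
def det3 (a b c : Fin 3 → ZMod 2) : ZMod 2 :=
  a 0 * b 1 * c 2 + a 0 * b 2 * c 1 + a 1 * b 0 * c 2 + a 1 * b 2 * c 0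
    + a 2 * b 0 * c 1 + a 2 * b 1 * c 0

theorem det3_lin (p q : ZMod 2) (a b c : Fin 3 → ZMod 2) :
    det3 (lin p q a) (lin p q b) (lin p q c) = det3 a b c := by
  simp only [det3, lin]
  simp
  have h : (2 : ZMod 2) = 0 := rfl
  linear_combination (p * (a 0 * b 1 * c 0 + a 0 * b 0 * c 1 + a 1 * b 0 * c 0)
    + q * (a 0 * b 1 * c 1 + a 1 * b 1 * c 0 + a 1 * b 0 * c 1)) * h

/-- slot to factor -/
def J {n : ℕ} (hn : 2 ≤ n) (k : ℕ) : Fin n :=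
  ⟨if k < 4 then 1 else min (k / 2) (n - 1), by split_ifs <;> omega⟩

/-- The multilinear form. -/
def Psi {n : ℕ} (hn : 2 ≤ n) (v : ℕ → Fin n → Fin 3 → ZMod 2) : ZMod 2 :=
  v 0 (J hn 0) 0 * det3 (v 1 (J hn 1)) (v 2 (J hn 2)) (v 3 (J hn 3)) *
    ∏ k ∈ Finset.Ico 4 (2 * n), v k (J hn k) 0

theorem Psi_add {n : ℕ} (hn : 2 ≤ n) (v : ℕ → Fin n → Fin 3 → ZMod 2) (i : ℕ)
    (a b : Fin n → Fin 3 → ZMod 2) (hi : i < 2 * n) : Psi hn (Function.update v i (a + b)) =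
    Psi hn (Function.update v i a) + Psi hn (Function.update v i b) := by
  by_cases h4 : i < 4
  · have hp : ∀ a, ∏ k ∈ Finset.Ico 4 (2 * n), (Function.update v i a) k (J hn k) 0 =
      ∏ k ∈ Finset.Ico 4 (2 * n), v k (J hn k) 0 := by
      intro a
      apply Finset.prod_congr rfl
      intro k hk
      have : k ≠ i := by simp at hk; omega
      simp [this]
    simp only [Psi, hp]
    interval_cases i <;> simp [det3] <;> ring
  · have hmem : i ∈ Finset.Ico 4 (2 * n) := by simp; omega
    have hp : ∀ a : Fin n → Fin 3 → ZMod 2, ∏ k ∈ Finset.Ico 4 (2 * n), (Function.update v i a) k (J hn k) 0 =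
      a (J hn i) 0 * ∏ k ∈ (Finset.Ico 4 (2 * n)).erase i, v k (J hn k) 0 := by
      intro a
      rw [← Finset.mul_prod_erase _ _ hmem]
      congr 1
      · simp
      · apply Finset.prod_congr rfl
        intro k hk
        have : k ≠ i := Finset.ne_of_mem_erase hk
        simp [this]
    simp only [Psi, hp]
    have h0 : (0 : ℕ) ≠ i := by omega
    have h1 : (1 : ℕ) ≠ i := by omega
    have h2 : (2 : ℕ) ≠ i := by omega
    have h3 : (3 : ℕ) ≠ i := by omega
    simp [h0, h1, h2, h3]
    ring

theorem Psi_congr {n : ℕ} (hn : 2 ≤ n) (v w : ℕ → Fin n → Fin 3 → ZMod 2)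
    (h : ∀ k, k < 2 * n → v k = w k) : Psi hn v = Psi hn w := by
  simp only [Psi]
  rw [h 0 (by omega), h 1 (by omega), h 2 (by omega), h 3 (by omega)]
  congr 1
  apply Finset.prod_congr rfl
  intro k hk
  rw [h k (by simp at hk; omega)]

/-- linear part of a generator; `false` is the glide reflection -/
def LL {n : ℕ} (γ : Bool × Fin n) : (Fin n → Fin 3 → ZMod 2) →+ (Fin n → Fin 3 → ZMod 2) where
  toFun v j := if (j : ℕ) = 0 then v j else if γ.2 = j then lin 1 0 (v j)
    else if γ.1 = true ∧ (γ.2 : ℕ) = 0 then lin 0 1 (v j) else lin 0 0 (v j)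
  map_zero' := by funext j; simp
  map_add' v w := by funext j; simp only [Pi.add_apply, map_add]; split_ifs <;> rfl

theorem Psi_LL {n : ℕ} (hn : 2 ≤ n) (γ : Bool × Fin n) (v : ℕ → Fin n → Fin 3 → ZMod 2) :
    Psi hn (fun k => LL γ (v k)) = Psi hn v := by
  have hX : ∀ (w : Fin n → Fin 3 → ZMod 2) j, LL γ w j 0 = w j 0 := by
    intro w j
    simp only [LL, AddMonoidHom.coe_mk, ZeroHom.coe_mk]
    split_ifs <;> simp [lin]
  have h1 : J hn 1 = J hn 0 := rfl
  have h2 : J hn 2 = J hn 0 := rfl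
  have h3 : J hn 3 = J hn 0 := rfl
  simp only [Psi, hX, h1, h2, h3]
  congr 2
  simp only [LL, AddMonoidHom.coe_mk, ZeroHom.coe_mk]
  split_ifs <;> simp only [det3_lin]

/-- generator action on vertices -/
def actV {n : ℕ} (M : ℕ) (γ : Bool × Fin n) (v : Fin n × Bool → ℤ) : Fin n × Bool → ℤ :=
  if γ.1 then betaV M γ.2 v else alphaV M γ.2 v

/-- The concrete data. -/
def cup {n : ℕ} (hn : 2 ≤ n) (M : ℕ) [NeZero M] :
    CupData (Fin n × Bool → ℤ) (Fin n → Fin 3 → ZMod 2) (Bool × Fin n) (2 * n) where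
  T := tot (m := 2 * n) M
  T_add F G := by
    simp only [tot, Pi.add_apply, Finset.sum_add_distrib]
  act := actV M
  L := LL
  Ψ := Psi hn
  Ψ_add := Psi_add hn
  Ψ_congr := Psi_congr hn
  Ψ_L := Psi_LL hn
  T_zero F hinv := by
    rintro ⟨l, hl, h⟩
    exact tot_eq_zero M F (fun j P => hinv (false, j) P) (fun j P => hinv (true, j) P)
      (by omega) l hl h

/-- affine part -/
def CC {n : ℕ} (γ : Bool × Fin n) : Fin n → Fin 3 → ZMod 2 := fun j =>
  if (j : ℕ) = 0 then 0 else if γ.2 = j then (if γ.1 then ![1, 1, 1] else ![0, 1, 0])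
  else if (γ.2 : ℕ) = 0 then (if γ.1 then ![1, 1, 0] else ![0, 1, 0]) else 0

theorem lab_zero : lab (0, 0) = 0 := by ext i; fin_cases i <;> simp [lab]

theorem equi_of_gequi {n : ℕ} (hn : 2 ≤ n) (M : ℕ) [NeZero M]
    {g : (Fin n × Bool → ℤ) → Fin n → ℤ × ℤ} (hg : GEqui M g) :
    (cup hn M).Equi CC (fun v j => lab (g v j)) := by
  rintro ⟨γ, j⟩ v
  funext l
  by_cases hl : (l : ℕ) = 0
  · have h1 := hg.zero v l hl
    have h2 := hg.zero (actV M (γ, j) v) l hl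
    simp [cup, LL, CC, hl, h1, h2]
  cases γ
  · simp only [cup, actV, Bool.false_eq_true, if_false, hg.alpha, LL, CC, hl, Pi.add_apply,
      AddMonoidHom.coe_mk, ZeroHom.coe_mk, false_and]
    by_cases h1 : j = l
    · subst h1
      simp only [if_true, hl, if_false, id]
      exact lab_rA _
    · have h1' : ¬ l = j := fun h => h1 h.symm
      simp only [h1, h1', if_false, id]
      by_cases h0 : (j : ℕ) = 0
      · simp only [h0, if_true]; exact lab_lA _
      · simp only [h0, if_false, id, lin_zero, add_zero]
  · simp only [cup, actV, if_true, hg.beta, LL, CC, hl, Pi.add_apply, if_false,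
      AddMonoidHom.coe_mk, ZeroHom.coe_mk, true_and]
    by_cases h1 : j = l
    · subst h1
      simp only [if_true, hl, if_false, id]
      exact lab_rB _
    · have h1' : ¬ l = j := fun h => h1 h.symm
      simp only [h1, h1', if_false, id]
      by_cases h0 : (j : ℕ) = 0
      · simp only [h0, if_true]; exact lab_lB _
      · simp only [h0, if_false, id, lin_zero, add_zero]

end KleinTC

namespace KleinTC

/-- state functions -/
def sI (a k : ℕ) : ℤ := if a < k then -1 else 0
/-- state functions -/
def sK (a t : ℕ) (u : Bool) (k : ℕ) : ℤ := if t < k ∧ (a < k ↔ u = true) then -1 else 0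
/-- reference in terms of states -/
def refS (a0 t0 : ℕ) (u0 : Bool) (a1 t1 : ℕ) (u1 : Bool) (k : ℕ) : ℤ × ℤ :=
  (sI a0 k - sI a1 k, sg (sI a1 k) * (sK a0 t0 u0 k - sK a1 t1 u1 k))
/-- differences -/
def dS (a0 t0 : ℕ) (u0 : Bool) (a1 t1 : ℕ) (u1 : Bool) (k : ℕ) : Fin 3 → ZMod 2 :=
  lab (refS a0 t0 u0 a1 t1 u1 (k + 1)) - lab (refS a0 t0 u0 a1 t1 u1 k)
/-- block of the first four slots -/
def block (a0 t0 : ℕ) (u0 : Bool) (a1 t1 : ℕ) (u1 : Bool) : ZMod 2 :=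
  dS a0 t0 u0 a1 t1 u1 0 0 * det3 (dS a0 t0 u0 a1 t1 u1 1) (dS a0 t0 u0 a1 t1 u1 2)
    (dS a0 t0 u0 a1 t1 u1 3)

set_option synthInstance.maxSize 1000 in
set_option synthInstance.maxHeartbeats 400000 in
theorem block_ne (a0 t0 a1 t1 : Fin 4) (u0 u1 : Bool)
    (h : block a0 t0 u0 a1 t1 u1 ≠ 0) (h1 : a0 ≠ t0) (h2 : a0 ≠ a1) (h3 : a0 ≠ t1) (h4 : t0 ≠ a1)
    (h5 : t0 ≠ t1) (h6 : a1 ≠ t1) :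
    t0 = 0 ∧ a0 = 1 ∧ t1 = 2 ∧ a1 = 3 ∧ u0 = false ∧ u1 = false := by
  revert a0 t0 a1 t1 u0 u1
  decide +kernel

theorem block_one : block 1 0 false 3 2 false = 1 := by decide +kernel

end KleinTC

namespace KleinTC

/-- floor of the glide coordinate -/
def fI {n : ℕ} (M : ℕ) (v : Fin n × Bool → ℤ) (j : Fin n) : ℤ := v (j, false) / (2 * M)
/-- floor of the other coordinate -/
def fK {n : ℕ} (M : ℕ) (v : Fin n × Bool → ℤ) (j : Fin n) : ℤ :=
  (sg (fI M v j) * v (j, true)) / (2 * M)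
/-- reference labels -/
def ref {n : ℕ} (hn : 2 ≤ n) (M : ℕ) (v : Fin n × Bool → ℤ) (j : Fin n) : ℤ × ℤ :=
  (fI M v ⟨0, by omega⟩ - fI M v j, sg (fI M v j) * (fK M v ⟨0, by omega⟩ - fK M v j))

theorem fI_alpha {n : ℕ} (M : ℕ) [NeZero M] (v : Fin n × Bool → ℤ) (j l : Fin n) :
    fI M (alphaV M j v) l = if l = j then fI M v l + 1 else fI M v l := by
  have hM : ((2 : ℤ) * M) ≠ 0 := by have := NeZero.ne M; positivity
  split_ifs with h
  · subst h
    simp only [fI, alphaV, if_true]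
    rw [Int.add_ediv_of_dvd_right dvd_rfl, Int.ediv_self hM]
  · simp [fI, alphaV, h]

theorem fK_alpha {n : ℕ} (M : ℕ) [NeZero M] (v : Fin n × Bool → ℤ) (j l : Fin n) :
    fK M (alphaV M j v) l = fK M v l := by
  simp only [fK, fI_alpha]
  by_cases h : l = j
  · subst h
    simp [alphaV, sg_add, sg_one]
  · simp [h, alphaV]

theorem fI_beta {n : ℕ} (M : ℕ) (v : Fin n × Bool → ℤ) (j l : Fin n) :
    fI M (betaV M j v) l = fI M v l := by
  simp [fI, betaV]

theorem fK_beta {n : ℕ} (M : ℕ) [NeZero M] (v : Fin n × Bool → ℤ) (j l : Fin n) :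
    fK M (betaV M j v) l = if l = j then fK M v l + sg (fI M v l) else fK M v l := by
  have hM : ((2 : ℤ) * M) ≠ 0 := by have := NeZero.ne M; positivity
  simp only [fK, fI_beta]
  split_ifs with h
  · subst h
    simp only [betaV, if_true]
    rw [mul_add, Int.add_ediv_of_dvd_right (Dvd.intro_left _ rfl), Int.mul_ediv_cancel _ hM]
  · simp [h, betaV]

theorem gequi_ref {n : ℕ} (hn : 2 ≤ n) (M : ℕ) [NeZero M] : GEqui M (ref hn M) where
  zero v j hj := by
    have : j = ⟨0, by have := j.2; omega⟩ := Fin.ext hj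
    simp only [ref]
    rw [← this]; simp
  alpha v j l := by
    simp only [ref, fI_alpha, fK_alpha]
    have e0 : ((⟨0, by omega⟩ : Fin n) = j) ↔ (j : ℕ) = 0 := by
      rw [Fin.ext_iff]; exact eq_comm
    simp only [e0]
    by_cases h1 : l = j <;> by_cases h0 : (j : ℕ) = 0 <;>
      simp only [h1, h0, if_true, if_false, rA, lA, id, sg_add, sg_one] <;> ext <;> simp <;> ring
  beta v j l := by
    simp only [ref, fI_beta, fK_beta]
    have e0 : ((⟨0, by omega⟩ : Fin n) = j) ↔ (j : ℕ) = 0 := by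
      rw [Fin.ext_iff]; exact eq_comm
    simp only [e0]
    have hh := sg_mul_self (fI M v l)
    have hj := sg_mul_self (fI M v j)
    by_cases h1 : l = j <;> by_cases h0 : (j : ℕ) = 0 <;>
      simp only [h1, h0, if_true, if_false, rB, lB, id, sg_sub] <;> ext <;> simp
    · linear_combination (-1 : ℤ) * hj
    · linear_combination (-1 : ℤ) * hj
    · ring

theorem unit_bounds (u : ℤˣ) : -1 ≤ (u : ℤ) ∧ (u : ℤ) ≤ 1 := by
  rcases Int.units_eq_one_or u with h | h <;> rw [h] <;> decide

theorem val_bounds {ι : Type} {M : ℕ} [NeZero M] (b : ι → ZMod M) (c : ι) :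
    0 ≤ lft b c ∧ lft b c ≤ M - 1 ∧ (b c ≠ 0 → 1 ≤ lft b c) := by
  have := ZMod.val_lt (b c)
  refine ⟨by simp only [lft]; positivity, by simp only [lft]; omega, ?_⟩
  intro h
  have : (b c).val ≠ 0 := by simpa using h
  simp only [lft]; omega

theorem chain_bounds {ι : Type} {m M : ℕ} [NeZero M] (b : ι → ZMod M) (ε : ι → ℤˣ)
    (e : ι ≃ Fin m) (k : ℕ) (c : ι) : -1 ≤ chainPt (lft b) ε e k c ∧
      chainPt (lft b) ε e k c ≤ 2 * M - 1 ∧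
      (b c ≠ 0 → 1 ≤ chainPt (lft b) ε e k c) ∧
      (ε c = 1 → 0 ≤ chainPt (lft b) ε e k c) := by
  have h1 := val_bounds b c
  have h2 := unit_bounds (ε c)
  simp only [chainPt]
  refine ⟨?_, ?_, ?_, ?_⟩
  · split_ifs <;> omega
  · split_ifs <;> omega
  · intro h; have := h1.2.2 h
    split_ifs <;> omega
  · intro h; rw [h]
    split_ifs <;> simp <;> omega

theorem div_small {M : ℕ} {a : ℤ} (h0 : 0 ≤ a) (h1 : a ≤ 2 * M - 1) : a / (2 * M) = 0 :=
  Int.ediv_eq_zero_of_lt h0 (by omega)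

theorem div_neg' {M : ℕ} {a : ℤ} (h0 : a ≤ -1) (h1 : - (2 * M) ≤ a) : a / (2 * M) = -1 := by
  by_cases hM : M = 0
  · subst hM; simp at h1; omega
  have : (0 : ℤ) < 2 * M := by omega
  rw [Int.ediv_eq_iff_of_pos this]
  constructor <;> linarith

theorem fI_chain {n m M : ℕ} [NeZero M] (b : Fin n × Bool → ZMod M) (ε : Fin n × Bool → ℤˣ)
    (e : Fin n × Bool ≃ Fin m) (k : ℕ) (j : Fin n) :
    fI M (chainPt (lft b) ε e k) j = 0 ∨ fI M (chainPt (lft b) ε e k) j = -1 := by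
  have h := chain_bounds b ε e k (j, false)
  have hM : 0 < M := Nat.pos_of_ne_zero (NeZero.ne M)
  by_cases h0 : 0 ≤ chainPt (lft b) ε e k (j, false)
  · left; exact div_small h0 h.2.1
  · right; exact div_neg' (by omega) (by omega)

theorem chain_off {ι : Type} {m : ℕ} (b : ι → ℤ) (ε : ι → ℤˣ)
    (e : ι ≃ Fin m) (k : ℕ) (c : ι) (hc : (e c : ℕ) ≠ k) :
    chainPt b ε e (k + 1) c = chainPt b ε e k c := by
  simp only [chainPt]
  have : (e c : ℕ) < k + 1 ↔ (e c : ℕ) < k := by omega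
  simp only [this]

theorem move_s {n m M : ℕ} [NeZero M] (b : Fin n × Bool → ZMod M) (ε : Fin n × Bool → ℤˣ)
    (e : Fin n × Bool ≃ Fin m) (k : ℕ) (j : Fin n)
    (h : (e (j, false) : ℕ) = k → ¬ (b (j, false) = 0 ∧ ε (j, false) = -1)) :
    fI M (chainPt (lft b) ε e (k + 1)) j = fI M (chainPt (lft b) ε e k) j := by
  by_cases hk : (e (j, false) : ℕ) = k
  · have h' := h hk
    have key : ∀ k, fI M (chainPt (lft b) ε e k) j = 0 := by
      intro k
      have hb := chain_bounds b ε e k (j, false)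
      apply div_small _ hb.2.1
      by_cases h0 : b (j, false) = 0
      · have : ε (j, false) = 1 := by
          rcases Int.units_eq_one_or (ε (j, false)) with h | h
          · exact h
          · exact absurd ⟨h0, h⟩ h'
        exact hb.2.2.2 this
      · have := hb.2.2.1 h0; omega
    rw [key, key]
  · simp only [fI, chain_off _ _ _ _ _ hk]

theorem move_t {n m M : ℕ} [NeZero M] (b : Fin n × Bool → ZMod M) (ε : Fin n × Bool → ℤˣ)
    (e : Fin n × Bool ≃ Fin m) (k : ℕ) (j : Fin n)
    (hI : fI M (chainPt (lft b) ε e (k + 1)) j = fI M (chainPt (lft b) ε e k) j)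
    (h : (e (j, true) : ℕ) = k → b (j, true) ≠ 0) :
    fK M (chainPt (lft b) ε e (k + 1)) j = fK M (chainPt (lft b) ε e k) j := by
  by_cases hk : (e (j, true) : ℕ) = k
  · have h' := h hk
    simp only [fK, hI]
    have h1 := chain_bounds b ε e k (j, true)
    have h2 := chain_bounds b ε e (k + 1) (j, true)
    have h1' := h1.2.2.1 h'
    have h2' := h2.2.2.1 h'
    rcases fI_chain b ε e k j with h0 | h0 <;> rw [h0]
    · rw [sg_zero, one_mul, one_mul, div_small (by omega) (by omega),
        div_small (by omega) (by omega)]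
    · rw [show sg (-1) = -1 from rfl, div_neg' (by omega) (by omega), div_neg' (by omega) (by omega)]
  · simp only [fK, hI, chain_off _ _ _ _ _ hk]

theorem move_ref {n m M : ℕ} (hn : 2 ≤ n) [NeZero M] (b : Fin n × Bool → ZMod M)
    (ε : Fin n × Bool → ℤˣ) (e : Fin n × Bool ≃ Fin m) (k : ℕ) (hk : k < m) (j : Fin n)
    (hne : ref hn M (chainPt (lft b) ε e (k + 1)) j ≠ ref hn M (chainPt (lft b) ε e k) j) :
    ∃ c : Fin n × Bool, (e c : ℕ) = k ∧ (c.1 = ⟨0, by omega⟩ ∨ c.1 = j) ∧ b c = 0 ∧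
      (c.2 = false → ε c = -1) := by
  by_contra hcon
  push Not at hcon
  have key : ∀ i : Fin n, (i = ⟨0, by omega⟩ ∨ i = j) →
      fI M (chainPt (lft b) ε e (k + 1)) i = fI M (chainPt (lft b) ε e k) i ∧
      fK M (chainPt (lft b) ε e (k + 1)) i = fK M (chainPt (lft b) ε e k) i := by
    intro i hi
    have h1 := move_s b ε e k i (fun hk hb => by
      have := hcon (i, false) hk hi hb.1
      exact this.2 hb.2)
    refine ⟨h1, move_t b ε e k i h1 (fun hk hb => ?_)⟩
    have := hcon (i, true) hk hi hb
    simp at this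
  apply hne
  have h0 := key ⟨0, by omega⟩ (Or.inl rfl)
  have h1 := key j (Or.inr rfl)
  simp only [ref, h0.1, h0.2, h1.1, h1.2]

theorem ref_state {n m M : ℕ} (hn : 2 ≤ n) [NeZero M] (b : Fin n × Bool → ZMod M)
    (ε : Fin n × Bool → ℤˣ) (e : Fin n × Bool ≃ Fin m) (hb : ∀ c, b c = 0)
    (hε : ∀ j, ε (j, false) = -1) (k : ℕ) (j : Fin n) :
    ref hn M (chainPt (lft b) ε e k) j =
      refS (e (⟨0, by omega⟩, false)) (e (⟨0, by omega⟩, true)) (ε (⟨0, by omega⟩, true) = 1)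
       (e (j, false)) (e (j, true)) (ε (j, true) = 1) k := by
  have hM : 0 < M := Nat.pos_of_ne_zero (NeZero.ne M)
  have hI : ∀ j, fI M (chainPt (lft b) ε e k) j = sI (e (j, false)) k := by
    intro j
    simp only [fI, chainPt, lft, hb, hε, sI]
    split_ifs
    · simp only [ZMod.val_zero]
      rw [div_neg'] <;> simp <;> omega
    · simp
  have hK : ∀ j, fK M (chainPt (lft b) ε e k) j =
      sK (e (j, false)) (e (j, true)) (ε (j, true) = 1) k := by
    intro j
    simp only [fK, hI, chainPt, lft, hb, sK, sI]
    simp only [ZMod.val_zero]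
    by_cases h1 : (e (j, true) : ℕ) < k
    · by_cases h2 : (e (j, false) : ℕ) < k
      · rcases Int.units_eq_one_or (ε (j, true)) with h | h
        · simp only [h1, h2, h, if_true, show sg (-1) = -1 from rfl]
          rw [div_neg'] <;> simp <;> omega
        · simp only [h1, h2, h, if_true, show sg (-1) = -1 from rfl]
          rw [div_small] <;> simp <;> omega
      · rcases Int.units_eq_one_or (ε (j, true)) with h | h
        · simp only [h1, h2, h, if_true, if_false, sg_zero]
          rw [div_small] <;> simp <;> omega
        · simp only [h1, h2, h, if_true, if_false, sg_zero]
          rw [div_neg'] <;> simp <;> omega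
    · simp [h1]
  simp only [ref, refS, hI, hK]

end KleinTC

namespace KleinTC

/-- The special ordering. -/
def e0 (n : ℕ) : Fin n × Bool ≃ Fin (2 * n) where
  toFun c := ⟨2 * c.1 + (if c.2 then 0 else 1), by have := c.1.2; split_ifs <;> omega⟩
  invFun k := (⟨k / 2, by omega⟩, decide ((k : ℕ) % 2 = 0))
  left_inv := by
    rintro ⟨j, x⟩
    cases x
    · ext <;> simp; omega
    · simp
  right_inv := by
    intro k
    ext
    simp
    split_ifs <;> omega

/-- the label difference -/
def dd {n M : ℕ} (hn : 2 ≤ n) (b : Fin n × Bool → ZMod M)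
    (ε : Fin n × Bool → ℤˣ) (e : Fin n × Bool ≃ Fin (2 * n)) (k : ℕ) (j : Fin n) :
    Fin 3 → ZMod 2 :=
  lab (ref hn M (chainPt (lft b) ε e (k + 1)) j) - lab (ref hn M (chainPt (lft b) ε e k) j)

theorem Psi_ne {n : ℕ} (hn : 2 ≤ n) (v : ℕ → Fin n → Fin 3 → ZMod 2) (h : Psi hn v ≠ 0) :
    (∀ k, k < 2 * n → v k (J hn k) ≠ 0) ∧ (∀ k, 4 ≤ k → k < 2 * n → v k (J hn k) 0 ≠ 0) ∧
      v 0 (J hn 0) 0 * det3 (v 1 (J hn 0)) (v 2 (J hn 0)) (v 3 (J hn 0)) ≠ 0 := by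
  have h1 := left_ne_zero_of_mul h
  have h2 := right_ne_zero_of_mul h
  rw [Finset.prod_ne_zero_iff] at h2
  have h3 := left_ne_zero_of_mul h1
  have h4 := right_ne_zero_of_mul h1
  refine ⟨?_, ?_, h1⟩
  · intro k hk h0
    by_cases h : k < 4
    · interval_cases k
      · simp [h0] at h3
      · apply h4; simp [det3, h0]
      · apply h4; simp [det3, h0]
      · apply h4; simp [det3, h0]
    · exact h2 k (by simp; omega) (by simp [h0])
  · intro k h4 hk
    exact h2 k (by simp; omega)

theorem J_val_lt {n : ℕ} (hn : 2 ≤ n) {k : ℕ} (hk : k < 4) : (J hn k : ℕ) = 1 := by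
  simp [J, hk]

theorem J_val_ge {n : ℕ} (hn : 2 ≤ n) {k : ℕ} (hk : 4 ≤ k) (hk' : k < 2 * n) :
    (J hn k : ℕ) = k / 2 := by
  have : ¬ k < 4 := by omega
  simp [J, this]; omega

theorem unique_flag {n M : ℕ} [NeZero M] (hn : 2 ≤ n) (b : Fin n × Bool → ZMod M)
    (ε : Fin n × Bool → ℤˣ) (e : Fin n × Bool ≃ Fin (2 * n))
    (hne : Psi hn (fun k j => dd hn b ε e k j) ≠ 0) :
    e = e0 n ∧ b = 0 ∧ ε = -1 := by
  obtain ⟨h1, h2, h3⟩ := Psi_ne hn _ hne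
  have hmove : ∀ c : Fin n × Bool, ((c.1 : ℕ) = 0 ∨ c.1 = J hn (e c)) ∧ b c = 0 ∧
      (c.2 = false → ε c = -1) := by
    intro c
    have hk := (e c).2
    obtain ⟨c', hc', h⟩ := move_ref hn b ε e (e c) hk (J hn (e c)) (fun hh => h1 _ hk (by
      simp only [dd, hh, sub_self]))
    have : c' = c := e.injective (Fin.ext hc')
    subst this
    refine ⟨?_, h.2⟩
    rcases h.1 with h | h
    · left; rw [h]
    · right; exact h
  have hb : ∀ c, b c = 0 := fun c => (hmove c).2.1
  have hεs : ∀ j, ε (j, false) = -1 := fun j => (hmove (j, false)).2.2 rfl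
  have hst := fun k j => ref_state hn b ε e hb hεs k j
  -- position of the factors
  have hpos2 : ∀ (j : Fin n) (x : Bool), 2 ≤ (j : ℕ) →
      (e (j, x) : ℕ) = 2 * j ∨ (e (j, x) : ℕ) = 2 * j + 1 := by
    intro j x hj
    have hlt := (e (j, x)).2
    rcases (hmove (j, x)).1 with h | h
    · simp at h; omega
    · have h := congrArg Fin.val h
      simp only at h
      by_cases h4 : (e (j, x) : ℕ) < 4
      · rw [J_val_lt hn h4] at h; omega
      · rw [J_val_ge hn (by omega) hlt] at h; omega
  have hne_e : ∀ c c' : Fin n × Bool, c ≠ c' → (e c : ℕ) ≠ (e c' : ℕ) := by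
    intro c c' h h'
    exact h (e.injective (Fin.ext h'))
  have hpos1 : ∀ (j : Fin n) (x : Bool), (j : ℕ) < 2 → (e (j, x) : ℕ) < 4 := by
    intro j x hj
    by_contra hcon
    have hlt := (e (j, x)).2
    set q : Fin n := ⟨(e (j, x) : ℕ) / 2, by omega⟩ with hq
    have hq2 : 2 ≤ (q : ℕ) := by simp only [hq]; omega
    have a1 := hpos2 q false hq2
    have a2 := hpos2 q true hq2
    have a3 := hne_e (q, false) (q, true) (by simp)
    have hqj : j ≠ q := by intro h; rw [← h] at hq2; omega
    have a4 := hne_e (j, x) (q, false) (by simp [hqj])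
    have a5 := hne_e (j, x) (q, true) (by simp [hqj])
    have : (q : ℕ) = (e (j, x) : ℕ) / 2 := rfl
    omega
  set z : Fin n := ⟨0, by omega⟩ with hz
  have hJ0 : J hn 0 = ⟨1, by omega⟩ := by ext; simp [J]
  set o : Fin n := ⟨1, by omega⟩ with ho
  have hzo : z ≠ o := by simp [hz, ho]
  have hblk : block (e (z, false)) (e (z, true)) (ε (z, true) = 1)
      (e (o, false)) (e (o, true)) (ε (o, true) = 1) ≠ 0 := by
    rw [hJ0] at h3
    simp only [dd, hst] at h3
    exact h3
  have hz4 := fun x => hpos1 z x (by simp [hz])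
  have ho4 := fun x => hpos1 o x (by simp [ho])
  have hb4 := block_ne ⟨_, hz4 false⟩ ⟨_, hz4 true⟩ ⟨_, ho4 false⟩ ⟨_, ho4 true⟩ _ _ hblk
    (fun h => hne_e (z, false) (z, true) (by simp) (by simpa using h))
    (fun h => hne_e (z, false) (o, false) (by simp [hzo]) (by simpa using h))
    (fun h => hne_e (z, false) (o, true) (by simp [hzo]) (by simpa using h))
    (fun h => hne_e (z, true) (o, false) (by simp [hzo]) (by simpa using h))
    (fun h => hne_e (z, true) (o, true) (by simp [hzo]) (by simpa using h))
    (fun h => hne_e (o, false) (o, true) (by simp) (by simpa using h))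
  simp only [Fin.ext_iff, decide_eq_false_iff_not] at hb4
  obtain ⟨b1, b2, b3, b4, b5, b6⟩ := hb4
  have hlarge : ∀ j : Fin n, 2 ≤ (j : ℕ) → (e (j, true) : ℕ) = 2 * j ∧
      (e (j, false) : ℕ) = 2 * j + 1 ∧ ε (j, true) ≠ 1 := by
    intro j hj
    have a1 := hpos2 j true hj
    have a2 := hpos2 j false hj
    have a3 := hne_e (j, true) (j, false) (by simp)
    have hjl := j.2
    have hJ : J hn (2 * j) = j := by
      ext; rw [J_val_ge hn (by omega) (by omega)]; omega
    have hX := h2 (2 * j) (by omega) (by omega)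
    simp only [hJ, dd, hst] at hX
    have c1 := hz4 true
    have c2 := hz4 false
    have c3 : ((e (z, true)) : ℕ) < 2 * j := by omega
    have c4 : ((e (z, false)) : ℕ) < 2 * j := by omega
    have c5 : ((e (z, true)) : ℕ) < 2 * j + 1 := by omega
    have c6 : ((e (z, false)) : ℕ) < 2 * j + 1 := by omega
    rcases a1 with a1 | a1
    · have a2' : (e (j, false) : ℕ) = 2 * j + 1 := by omega
      refine ⟨a1, a2', ?_⟩
      intro hε
      apply hX
      simp [refS, lab, sI, sK, a1, a2', c3, c4, c5, c6, hε]
    · exfalso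
      have a2' : (e (j, false) : ℕ) = 2 * j := by omega
      apply hX
      simp [refS, lab, sI, sK, a1, a2', c3, c4, c5, c6, b5]
  have hall : ∀ j : Fin n, (e (j, true) : ℕ) = 2 * j ∧
      (e (j, false) : ℕ) = 2 * j + 1 ∧ ε (j, true) ≠ 1 := by
    intro j
    by_cases h0 : (j : ℕ) = 0
    · have : j = z := Fin.ext h0
      rw [this]; exact ⟨b1, b2, b5⟩
    · by_cases h1 : (j : ℕ) = 1
      · have : j = o := Fin.ext h1
        rw [this]; exact ⟨b3, b4, b6⟩
      · exact hlarge j (by omega)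
  refine ⟨?_, funext hb, ?_⟩
  · ext ⟨j, x⟩
    cases x
    · rw [(hall j).2.1]; rfl
    · rw [(hall j).1]; rfl
  · funext ⟨j, x⟩
    cases x
    · exact hεs j
    · rcases Int.units_eq_one_or (ε (j, true)) with h | h
      · exact absurd h (hall j).2.2
      · exact h

theorem special_flag {n M : ℕ} [NeZero M] (hn : 2 ≤ n) :
    Psi hn (fun k j => dd hn (0 : Fin n × Bool → ZMod M) (-1) (e0 n) k j) = 1 := by
  have hst := fun k j => ref_state hn (0 : Fin n × Bool → ZMod M) (-1) (e0 n) (fun _ => rfl)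
    (fun _ => rfl) k j
  simp only [Psi, dd, hst]
  rw [Finset.prod_eq_one, mul_one]
  · exact block_one
  · intro k hk
    simp only [Finset.mem_Ico] at hk
    have hJ := J_val_ge hn hk.1 hk.2
    have hu : ∀ j : Fin n, ¬ ((-1 : Fin n × Bool → ℤˣ) (j, true) = 1) := by
      intro j; simp
    rcases Nat.mod_two_eq_zero_or_one k with h | h
    · have e1 : ¬ (k / 2 * 2 + 1 < k + 1) := by omega
      have e2 : ¬ (2 * (k / 2) + 1 < k + 1) := by omega
      have e3 : ¬ (2 * (k / 2) + 1 < k) := by omega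
      have e4 : (2 * (k / 2) < k + 1) := by omega
      have e5 : ¬ (2 * (k / 2) < k) := by omega
      have e6 : 1 < k := by omega
      have e7 : 0 < k := by omega
      simp [refS, lab, sI, sK, hJ, e0, e2, e3, e4, e5, e6, e7, sg_zero]
    · have e2 : (2 * (k / 2) + 1 < k + 1) := by omega
      have e3 : ¬ (2 * (k / 2) + 1 < k) := by omega
      have e4 : (2 * (k / 2) < k + 1) := by omega
      have e5 : (2 * (k / 2) < k) := by omega
      have e6 : 1 < k := by omega
      have e7 : 0 < k := by omega
      simp [refS, lab, sI, sK, hJ, e0, e2, e3, e4, e5, e6, e7, sg_zero]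

theorem val_def {n M : ℕ} [NeZero M] (hn : 2 ≤ n)
    (x : ℕ → (Fin n × Bool → ℤ) → Fin n → Fin 3 → ZMod 2) :
    (cup hn M).val x = ∑ e : Fin n × Bool ≃ Fin (2 * n),
      ∑ y : (Fin n × Bool → ZMod M) × (Fin n × Bool → ℤˣ),
      Psi hn (fun k => x k (chainPt (lft y.1) y.2 e (k + 1)) - x k (chainPt (lft y.1) y.2 e k)) := rfl

theorem val_ref {n M : ℕ} [NeZero M] (hn : 2 ≤ n) :
    (cup hn M).val (fun _ v j => lab (ref hn M v j)) = 1 := by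
  rw [val_def]
  rw [Finset.sum_eq_single (e0 n), Finset.sum_eq_single ((0, -1))]
  · exact special_flag (M := M) hn
  · rintro ⟨b, ε⟩ _ hne
    by_contra hc
    obtain ⟨-, h1, h2⟩ := unique_flag hn b ε (e0 n) hc
    exact hne (by rw [h1, h2])
  · simp
  · intro e _ hne
    apply Finset.sum_eq_zero
    rintro ⟨b, ε⟩ _
    by_contra hc
    exact hne (unique_flag hn b ε e hc).1
  · simp

/-- The combinatorial theorem. -/
theorem comb {n M : ℕ} [NeZero M] (hn : 2 ≤ n)
    (g : ℕ → (Fin n × Bool → ℤ) → Fin n → ℤ × ℤ) (hg : ∀ k, GEqui M (g k)) :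
    ∃ (b : Fin n × Bool → ℤ) (ε : Fin n × Bool → ℤˣ) (e : Fin n × Bool ≃ Fin (2 * n)),
      (∀ c, 0 ≤ b c ∧ b c < M) ∧
      ∀ k, k < 2 * n → g k (chainPt b ε e k) ≠ g k (chainPt b ε e (k + 1)) := by
  have h1 : (cup hn M).val (fun k v j => lab (g k v j)) = 1 := by
    rw [← val_ref (M := M) hn]
    exact (cup hn M).val_eq (c := fun _ => CC) (fun k => equi_of_gequi hn M (gequi_ref hn M))
      (fun k => equi_of_gequi hn M (hg k))
  rw [val_def] at h1
  obtain ⟨e, -, he⟩ := Finset.exists_ne_zero_of_sum_ne_zero (h1.trans_ne one_ne_zero)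
  obtain ⟨⟨b, ε⟩, -, hx⟩ := Finset.exists_ne_zero_of_sum_ne_zero he
  refine ⟨lft b, ε, e, fun c => ?_, ?_⟩
  · have := val_bounds b c; omega
  · intro k hk h
    refine (Psi_ne hn _ hx).1 k hk ?_
    funext i
    simp only [Pi.sub_apply, h, sub_self]
    rfl

end KleinTC

namespace KleinTC
open Topology

/-- The Klein bottle group acting on the plane. -/
noncomputable def act (g : ℤ × ℤ) (x : ℝ × ℝ) : ℝ × ℝ := (x.1 + g.1, (sg g.1 : ℝ) * (x.2 + g.2))

/-- multiplication -/
def gmul (g h : ℤ × ℤ) : ℤ × ℤ := (g.1 + h.1, h.2 + sg h.1 * g.2)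

/-- inverse -/
def ginv (g : ℤ × ℤ) : ℤ × ℤ := (-g.1, - (sg g.1 * g.2))

theorem act_act (g h : ℤ × ℤ) (x : ℝ × ℝ) : act g (act h x) = act (gmul g h) x := by
  have h1 : (sg h.1 : ℝ) * sg h.1 = 1 := by exact_mod_cast sg_mul_self h.1
  ext
  · simp [act, gmul]; ring
  · simp only [act, gmul, sg_add]; push_cast
    linear_combination (- (sg g.1 : ℝ) * g.2) * h1

theorem act_zero (x : ℝ × ℝ) : act (0, 0) x = x := by
  simp [act, sg_zero]

theorem act_inj {g h : ℤ × ℤ} {x : ℝ × ℝ} (hgh : act g x = act h x) : g = h := by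
  have h1 := congrArg Prod.fst hgh
  have h2 := congrArg Prod.snd hgh
  simp only [act, add_right_inj, Int.cast_inj] at h1
  simp only [act, h1] at h2
  have h3 : (sg h.1 : ℝ) * sg h.1 = 1 := by exact_mod_cast sg_mul_self h.1
  have h4 : (g.2 : ℝ) = h.2 := by linear_combination (sg h.1 : ℝ) * h2 + (h.2 - g.2) * h3
  exact Prod.ext h1 (by exact_mod_cast h4)

theorem gmul_ginv (g : ℤ × ℤ) : gmul (ginv g) g = (0, 0) := by
  ext
  · simp [gmul, ginv]
  · simp only [gmul, ginv]
    linear_combination (-g.2) * sg_mul_self g.1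

theorem continuous_act (g : ℤ × ℤ) : Continuous (act g) := by
  unfold act; fun_prop

/-- The group. -/
structure KG where
  /-- underlying pair -/
  v : ℤ × ℤ

theorem KG.ext' {a b : KG} (h : a.v = b.v) : a = b := by cases a; cases b; congr

noncomputable instance : Group KG where
  mul a b := ⟨gmul a.v b.v⟩
  one := ⟨(0, 0)⟩
  inv a := ⟨ginv a.v⟩
  mul_assoc a b c := by
    apply KG.ext'
    apply act_inj (x := (0, 0))
    change act (gmul (gmul a.v b.v) c.v) _ = act (gmul a.v (gmul b.v c.v)) _
    simp only [← act_act]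
  one_mul a := by
    apply KG.ext'
    apply act_inj (x := (0, 0))
    change act (gmul (0, 0) a.v) _ = _
    simp only [← act_act, act_zero]
  mul_one a := by
    apply KG.ext'
    apply act_inj (x := (0, 0))
    change act (gmul a.v (0, 0)) _ = _
    simp only [← act_act, act_zero]
  inv_mul_cancel a := KG.ext' (gmul_ginv a.v)

noncomputable instance : MulAction KG (ℝ × ℝ) where
  smul a x := act a.v x
  one_smul x := act_zero x
  mul_smul a b x := (act_act a.v b.v x).symm

theorem KG.smul_def (a : KG) (x : ℝ × ℝ) : a • x = act a.v x := rfl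

/-- The hypotheses on the universal covering of the Klein bottle. -/
structure KleinCover {K : Type*} [TopologicalSpace K] (p : ℝ × ℝ → K) : Prop where
  quot : IsQuotientMap p
  fib : ∀ x y, p x = p y ↔ ∃ g, y = act g x

theorem KleinCover.qc {K : Type*} [TopologicalSpace K] {p : ℝ × ℝ → K} (hp : KleinCover p) :
    IsQuotientCoveringMap p KG where
  __ := hp.quot
  continuous_const_smul a := continuous_act a.v
  apply_eq_iff_mem_orbit {x y} := by
    rw [eq_comm, hp.fib]
    constructor
    · rintro ⟨g, rfl⟩; exact ⟨⟨g⟩, rfl⟩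
    · rintro ⟨g, rfl⟩; exact ⟨g.v, rfl⟩
  disjoint x := by
    refine ⟨Metric.ball x (1/4), Metric.ball_mem_nhds _ (by norm_num), ?_⟩
    rintro ⟨g⟩ ⟨z, ⟨y, hy, hyz⟩, hz⟩
    change act g y = z at hyz
    subst hyz
    rw [Metric.mem_ball, Prod.dist_eq, max_lt_iff, Real.dist_eq, Real.dist_eq, abs_lt, abs_lt]
      at hy hz
    simp only [act] at hz
    have h1 : g.1 = 0 := by
      have a1 : (g.1 : ℝ) < 1 := by linarith
      have a2 : (-1 : ℝ) < g.1 := by linarith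
      have a1 : g.1 < 1 := by exact_mod_cast a1
      have a2 : -1 < g.1 := by exact_mod_cast a2
      omega
    simp only [h1, sg_zero] at hz
    have h2 : g.2 = 0 := by
      push_cast at hz
      have a1 : (g.2 : ℝ) < 1 := by linarith
      have a2 : (-1 : ℝ) < g.2 := by linarith
      have a1 : g.2 < 1 := by exact_mod_cast a1
      have a2 : -1 < g.2 := by exact_mod_cast a2
      omega
    exact KG.ext' (Prod.ext h1 h2)

theorem KleinCover.cov {K : Type*} [TopologicalSpace K] {p : ℝ × ℝ → K} (hp : KleinCover p) :
    IsCoveringMap p := hp.qc.isCoveringMap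

theorem KleinCover.p_act {K : Type*} [TopologicalSpace K] {p : ℝ × ℝ → K} (hp : KleinCover p)
    (g : ℤ × ℤ) (x : ℝ × ℝ) : p (act g x) = p x := ((hp.fib _ _).2 ⟨g, rfl⟩).symm

end KleinTC

namespace KleinTC
open Topology
open scoped unitInterval

section lift
variable {K : Type*} [TopologicalSpace K] {p : ℝ × ℝ → K} {n : ℕ}

/-- `g` records the end points of the lifted path through the points `p (x j)`. -/
def LiftRel (p : ℝ × ℝ → K) (j0 : Fin n) (τ : Fin n → I) (U : Set (Fin n → K))
    (sec : C(U, C(I, K))) (x : Fin n → ℝ × ℝ) (g : Fin n → ℤ × ℤ) : Prop :=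
  ∃ hx : (fun j => p (x j)) ∈ U, ∃ Γ : C(I, ℝ × ℝ), (∀ t, p (Γ t) = sec ⟨_, hx⟩ t) ∧
    Γ 0 = x j0 ∧ ∀ j, Γ (τ j) = act (g j) (x j)

variable (hp : KleinCover p) (j0 : Fin n) (τ : Fin n → I) (hτ : τ j0 = 0)
  (U : Set (Fin n → K)) (sec : C(U, C(I, K))) (hsec : ∀ u j, sec u (τ j) = u.1 j)
include hp hτ hsec

theorem liftRel_exists (x : Fin n → ℝ × ℝ) (hx : (fun j => p (x j)) ∈ U) :
    ∃ g, LiftRel p j0 τ U sec x g := by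
  have h0 : sec ⟨_, hx⟩ 0 = p (x j0) := by rw [← hτ, hsec]
  obtain ⟨Γ, h1, h2⟩ := hp.cov.exists_path_lifts (sec ⟨_, hx⟩) (x j0) h0
  have h3 : ∀ t, p (Γ t) = sec ⟨_, hx⟩ t := fun t => congrFun h1 t
  have h4 : ∀ j, ∃ g, Γ (τ j) = act g (x j) := by
    intro j
    rw [← hp.fib, h3, hsec]
  choose g hg using h4
  exact ⟨g, hx, Γ, h3, h2, hg⟩

omit hτ hsec in
theorem liftRel_unique {x : Fin n → ℝ × ℝ} {g g' : Fin n → ℤ × ℤ}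
    (h : LiftRel p j0 τ U sec x g) (h' : LiftRel p j0 τ U sec x g') : g = g' := by
  obtain ⟨hx, Γ, h1, h2, h3⟩ := h
  obtain ⟨hx', Γ', h1', h2', h3'⟩ := h'
  have : (Γ : I → ℝ × ℝ) = Γ' := by
    refine hp.cov.eq_of_comp_eq Γ.continuous Γ'.continuous ?_ 0 (h2.trans h2'.symm)
    funext t; simp [h1, h1']
  funext j
  apply act_inj (x := x j)
  rw [← h3, ← h3', this]

omit hp hsec in
theorem liftRel_zero {x : Fin n → ℝ × ℝ} {g : Fin n → ℤ × ℤ}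
    (h : LiftRel p j0 τ U sec x g) : g j0 = (0, 0) := by
  obtain ⟨hx, Γ, h1, h2, h3⟩ := h
  apply act_inj (x := x j0)
  rw [← h3, hτ, h2, act_zero]

omit hτ hsec in
theorem liftRel_act {x : Fin n → ℝ × ℝ} {g : Fin n → ℤ × ℤ}
    (h : LiftRel p j0 τ U sec x g) (j : Fin n) (s : ℤ × ℤ) :
    LiftRel p j0 τ U sec (Function.update x j (act s (x j)))
      (fun l => (if l = j then fun u => gmul u (ginv s) else id)
        ((if j = j0 then gmul s else id) (g l))) := by
  obtain ⟨hx, Γ, h1, h2, h3⟩ := h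
  have hpx : (fun l => p (Function.update x j (act s (x j)) l)) = fun l => p (x l) := by
    funext l
    by_cases hl : l = j
    · subst hl; simp [hp.p_act]
    · simp [hl]
  have hinv : ∀ y, act (ginv s) (act s y) = y := fun y => by
    rw [act_act, gmul_ginv, act_zero]
  refine ⟨hpx ▸ hx, ?_⟩
  have hq : ∀ h' : (fun l => p (Function.update x j (act s (x j)) l)) ∈ U,
      (⟨_, h'⟩ : U) = ⟨_, hx⟩ := fun h' => Subtype.ext hpx
  rw [hq]
  by_cases hj : j = j0
  · refine ⟨⟨fun t => act s (Γ t), (continuous_act s).comp Γ.continuous⟩, ?_, ?_, ?_⟩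
    · intro t; simp [hp.p_act, h1]
    · simp [h2, hj]
    · intro l
      simp only [ContinuousMap.coe_mk, h3, if_pos hj]
      by_cases hl : l = j
      · subst hl; simp [← act_act, hinv]
      · simp [← act_act, hl]
  · refine ⟨Γ, h1, ?_, ?_⟩
    · rw [h2, Function.update_of_ne (Ne.symm hj)]
    · intro l
      simp only [h3, if_neg hj, id]
      by_cases hl : l = j
      · subst hl; simp [← act_act, hinv]
      · simp [hl]

theorem liftRel_const (S : Set (Fin n → ℝ × ℝ)) (hS : IsPreconnected S)
    (hSU : ∀ x ∈ S, (fun j => p (x j)) ∈ U) {x y : Fin n → ℝ × ℝ} (hx : x ∈ S) (hy : y ∈ S)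
    {g : Fin n → ℤ × ℤ} (h : LiftRel p j0 τ U sec x g) : LiftRel p j0 τ U sec y g := by
  have hpc : Continuous p := hp.quot.continuous
  have : PreconnectedSpace S := Subtype.preconnectedSpace hS
  have hev : ∀ j, Continuous (fun a : S => a.1 j) := fun j =>
    (continuous_apply j).comp continuous_subtype_val
  let q : C(S, U) := ⟨fun a => ⟨fun j => p (a.1 j), hSU _ a.2⟩,
    Continuous.subtype_mk (continuous_pi fun j => hpc.comp (hev j)) _⟩
  let H : C(I × S, K) := ⟨fun z => sec (q z.2) z.1, by fun_prop⟩
  let f : C(S, ℝ × ℝ) := ⟨fun a => a.1 j0, hev j0⟩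
  have H0 : ∀ a, H (0, a) = p (f a) := by
    intro a
    change sec (q a) 0 = p (a.1 j0)
    rw [← hτ, hsec]
    rfl
  let G := hp.cov.liftHomotopy H f H0
  have hG : ∀ z, p (G z) = H z := fun z => congrFun (hp.cov.liftHomotopy_lifts H f H0) z
  have hG0 : ∀ a, G (0, a) = a.1 j0 := hp.cov.liftHomotopy_zero H f H0
  obtain ⟨hx', Γ, h1, h2, h3⟩ := h
  have hΓ : (fun t => G (t, ⟨x, hx⟩)) = Γ := by
    refine hp.cov.eq_of_comp_eq (by fun_prop) Γ.continuous ?_ 0 ((hG0 _).trans h2.symm)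
    funext t
    simp only [Function.comp, hG, h1]
    rfl
  refine ⟨hSU _ hy, ⟨fun t => G (t, ⟨y, hy⟩), by fun_prop⟩, ?_, hG0 _, ?_⟩
  · intro t; exact hG _
  · intro j
    have hc : (fun a : S => G (τ j, a)) = fun a => act (g j) (a.1 j) := by
      refine hp.cov.eq_of_comp_eq (by fun_prop)
        ((continuous_act _).comp (hev j)) ?_ ⟨x, hx⟩ ?_
      · funext a
        simp only [Function.comp, hG, hp.p_act]
        exact hsec _ _
      · rw [← h3]; exact congrFun hΓ (τ j)
    exact congrFun hc ⟨y, hy⟩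

end lift

/-- position of the vertices -/
noncomputable def pos {n : ℕ} (M : ℕ) (v : Fin n × Bool → ℤ) : Fin n → ℝ × ℝ :=
  fun j => ((v (j, false) : ℝ) / (2 * M), (v (j, true) : ℝ) / (2 * M))

theorem pos_alpha {n : ℕ} (M : ℕ) [NeZero M] (v : Fin n × Bool → ℤ) (j : Fin n) :
    pos M (alphaV M j v) = Function.update (pos M v) j (act (1, 0) (pos M v j)) := by
  have hM : (M : ℝ) ≠ 0 := by exact_mod_cast NeZero.ne M
  funext l
  by_cases hl : l = j
  · subst hl
    simp only [pos, alphaV, act, Function.update_self, sg_one]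
    ext
    · simp; field_simp
    · simp; ring
  · simp [pos, alphaV, hl]

theorem pos_beta {n : ℕ} (M : ℕ) [NeZero M] (v : Fin n × Bool → ℤ) (j : Fin n) :
    pos M (betaV M j v) = Function.update (pos M v) j (act (0, 1) (pos M v j)) := by
  have hM : (M : ℝ) ≠ 0 := by exact_mod_cast NeZero.ne M
  funext l
  by_cases hl : l = j
  · subst hl
    simp only [pos, betaV, act, Function.update_self, sg_zero]
    ext
    · simp
    · simp; field_simp
  · simp [pos, betaV, hl]

theorem gmul_A (g : ℤ × ℤ) : gmul (1, 0) g = lA g := by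
  ext <;> simp [gmul, lA]; ring
theorem gmul_B (g : ℤ × ℤ) : gmul (0, 1) g = lB g := by
  ext <;> simp [gmul, lB]
theorem gmul_A' (g : ℤ × ℤ) : gmul g (ginv (1, 0)) = rA g := by
  ext <;> simp [gmul, rA, ginv, sg_neg, sg_one]; ring
theorem gmul_B' (g : ℤ × ℤ) : gmul g (ginv (0, 1)) = rB g := by
  ext <;> simp [gmul, rB, ginv, sg_zero]; ring

/-- geometric labels -/
theorem exists_label {K : Type*} [TopologicalSpace K] {p : ℝ × ℝ → K} {n : ℕ}
    (hp : KleinCover p) (hn : 2 ≤ n) (τ : Fin n → I) (hτ : ∀ j : Fin n, (j : ℕ) = 0 → τ j = 0)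
    (U : Set (Fin n → K)) (sec : C(U, C(I, K))) (hsec : ∀ u j, sec u (τ j) = u.1 j)
    (M : ℕ) [NeZero M] : ∃ g : (Fin n × Bool → ℤ) → Fin n → ℤ × ℤ, GEqui M g ∧
      ∀ (S : Set (Fin n → ℝ × ℝ)), IsPreconnected S → (∀ x ∈ S, (fun j => p (x j)) ∈ U) →
        ∀ v w, pos M v ∈ S → pos M w ∈ S → g v = g w := by
  classical
  set j0 : Fin n := ⟨0, by omega⟩ with hj0
  have hj : ∀ j : Fin n, (j : ℕ) = 0 ↔ j = j0 := fun j => by rw [Fin.ext_iff]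
  have hτ0 : τ j0 = 0 := hτ j0 rfl
  have hcond : ∀ (v : Fin n × Bool → ℤ) (j : Fin n) (s : ℤ × ℤ),
      (fun l => p (Function.update (pos M v) j (act s (pos M v j)) l)) =
        fun l => p (pos M v l) := by
    intro v j s
    funext l
    by_cases hl : l = j
    · subst hl; simp [hp.p_act]
    · simp [hl]
  let g : (Fin n × Bool → ℤ) → Fin n → ℤ × ℤ := fun v =>
    if h : (fun j => p (pos M v j)) ∈ U then
      (liftRel_exists hp j0 τ hτ0 U sec hsec (pos M v) h).choose else ref hn M v
  have hg1 : ∀ v, (fun j => p (pos M v j)) ∈ U → LiftRel p j0 τ U sec (pos M v) (g v) := by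
    intro v h
    simp only [g, dif_pos h]
    exact (liftRel_exists hp j0 τ hτ0 U sec hsec (pos M v) h).choose_spec
  have hg2 : ∀ v, (fun j => p (pos M v j)) ∉ U → g v = ref hn M v := by
    intro v h
    simp only [g, dif_neg h]
  have href := gequi_ref hn M
  refine ⟨g, ⟨?_, ?_, ?_⟩, ?_⟩
  · intro v j hj'
    by_cases h : (fun j => p (pos M v j)) ∈ U
    · rw [(hj j).1 hj']
      exact liftRel_zero j0 τ hτ0 U sec (hg1 v h)
    · rw [hg2 v h]; exact href.zero v j hj'
  · intro v j l
    by_cases h : (fun j => p (pos M v j)) ∈ U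
    · have h' : (fun l => p (pos M (alphaV M j v) l)) ∈ U := by
        rw [pos_alpha, hcond]; exact h
      have := liftRel_act hp j0 τ U sec (hg1 v h) j (1, 0)
      rw [← pos_alpha] at this
      rw [liftRel_unique hp j0 τ U sec (hg1 _ h') this]
      simp only [hj, funext gmul_A, funext gmul_A']
    · have h' : (fun l => p (pos M (alphaV M j v) l)) ∉ U := by
        rw [pos_alpha, hcond]; exact h
      rw [hg2 v h, hg2 _ h']
      exact href.alpha v j l
  · intro v j l
    by_cases h : (fun j => p (pos M v j)) ∈ U
    · have h' : (fun l => p (pos M (betaV M j v) l)) ∈ U := by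
        rw [pos_beta, hcond]; exact h
      have := liftRel_act hp j0 τ U sec (hg1 v h) j (0, 1)
      rw [← pos_beta] at this
      rw [liftRel_unique hp j0 τ U sec (hg1 _ h') this]
      simp only [hj, funext gmul_B, funext gmul_B']
    · have h' : (fun l => p (pos M (betaV M j v) l)) ∉ U := by
        rw [pos_beta, hcond]; exact h
      rw [hg2 v h, hg2 _ h']
      exact href.beta v j l
  · intro S hS hSU v w hv hw
    exact liftRel_unique hp j0 τ U sec
      (liftRel_const hp j0 τ hτ0 U sec hsec S hS hSU hv hw (hg1 v (hSU _ hv)))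
      (hg1 w (hSU _ hw))

/-- The lower bound. -/
theorem lower {K : Type*} [TopologicalSpace K] {p : ℝ × ℝ → K} {n : ℕ}
    (hp : KleinCover p) (hn : 2 ≤ n) (τ : Fin n → I) (hτ : ∀ j : Fin n, (j : ℕ) = 0 → τ j = 0)
    (k : ℕ) (U : Fin k → Set (Fin n → K)) (hU : ∀ i, IsOpen (U i)) (hcov : (⋃ i, U i) = Set.univ)
    (hs : ∀ i, ∃ sec : C(U i, C(I, K)), ∀ u j, sec u (τ j) = u.1 j) : 2 * n + 1 ≤ k := by
  by_contra hk
  have hk2 : k ≤ 2 * n := by omega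
  have hpc : Continuous p := hp.quot.continuous
  let V : Fin k → Set (Fin n → ℝ × ℝ) := fun i => {x | (fun j => p (x j)) ∈ U i}
  have hV : ∀ i, IsOpen (V i) := fun i => (hU i).preimage (by fun_prop)
  have hVc : ∀ x, ∃ i, x ∈ V i := fun x => by
    have : (fun j => p (x j)) ∈ ⋃ i, U i := by rw [hcov]; trivial
    obtain ⟨i, hi⟩ := Set.mem_iUnion.1 this
    exact ⟨i, hi⟩
  let B : Set (Fin n → ℝ × ℝ) := Set.Icc (fun _ => (0, 0)) (fun _ => (1, 1))
  have hB : IsCompact B := isCompact_Icc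
  obtain ⟨δ, hδ, hL⟩ := lebesgue_number_lemma_of_metric hB hV
    (fun x _ => Set.mem_iUnion.2 (hVc x))
  obtain ⟨M, hM⟩ := exists_nat_gt (1 / δ)
  have hM0 : 0 < (M : ℝ) := lt_trans (by positivity) hM
  have : NeZero M := ⟨by rintro rfl; simp at hM0⟩
  have hMδ : 1 / (M : ℝ) < δ := by
    rw [div_lt_iff₀ hδ] at hM; rw [div_lt_iff₀ hM0]; linarith
  choose sec hsec using hs
  choose g hg1 hg2 using fun i => exists_label hp hn τ hτ (U i) (sec i) (hsec i) M
  have hk0 : 0 < k := by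
    obtain ⟨i, -⟩ := hVc 0
    exact i.pos
  obtain ⟨b, ε, e, hb, hne⟩ := comb hn (fun i => if h : i < k then g ⟨i, h⟩ else g ⟨0, hk0⟩)
    (by intro i; split_ifs <;> apply hg1)
  -- center
  have hc : pos M (fun c => 2 * b c) ∈ B := by
    have h1 : ∀ c, 0 ≤ ((2 * b c : ℤ) : ℝ) / (2 * M) ∧ ((2 * b c : ℤ) : ℝ) / (2 * M) ≤ 1 := by
      intro c
      obtain ⟨h0, h1⟩ := hb c
      have h0 : (0 : ℝ) ≤ b c := by exact_mod_cast h0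
      have h1 : (b c : ℝ) ≤ M := by exact_mod_cast h1.le
      push_cast
      refine ⟨by positivity, ?_⟩
      rw [div_le_one (by positivity)]; linarith
    exact ⟨fun j => ⟨(h1 _).1, (h1 _).1⟩, fun j => ⟨(h1 _).2, (h1 _).2⟩⟩
  obtain ⟨i, hi⟩ := hL _ hc
  have hmem : ∀ q, pos M (chainPt b ε e q) ∈ Metric.ball (pos M (fun c => 2 * b c)) δ := by
    intro q
    have h1 : ∀ c, |((chainPt b ε e q c : ℤ) : ℝ) / (2 * M) - ((2 * b c : ℤ) : ℝ) / (2 * M)|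
        < δ := by
      intro c
      rw [← sub_div, ← Int.cast_sub, abs_div]
      refine lt_of_le_of_lt ?_ hMδ
      have : |chainPt b ε e q c - 2 * b c| ≤ 1 := by
        simp only [chainPt, add_sub_cancel_left]
        split_ifs
        · rcases Int.units_eq_one_or (ε c) with h | h <;> rw [h] <;> simp
        · simp
      have : |((chainPt b ε e q c - 2 * b c : ℤ) : ℝ)| ≤ 1 := by exact_mod_cast this
      rw [abs_of_pos (by positivity : (0 : ℝ) < 2 * M)]
      rw [div_le_div_iff₀ (by positivity) hM0]
      nlinarith
    rw [Metric.mem_ball, dist_pi_lt_iff hδ]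
    intro j
    rw [Prod.dist_eq, max_lt_iff, Real.dist_eq, Real.dist_eq]
    exact ⟨h1 _, h1 _⟩
  refine hne i (by omega) ?_
  simp only [dif_pos i.2]
  exact hg2 i _ (convex_ball _ _).isPreconnected (fun x hx => hi hx) _ _ (hmem _) (hmem _)

end KleinTC

namespace KleinTC
open Topology
open scoped unitInterval

section upper
variable {K : Type*} [TopologicalSpace K] {p : ℝ × ℝ → K}

theorem KleinCover.descend (hp : KleinCover p) (f : ℝ × ℝ → ℝ) (hf : Continuous f)
    (h : ∀ g x, f (act g x) = f x) : ∃ F : K → ℝ, Continuous F ∧ ∀ x, F (p x) = f x := by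
  have hs := hp.quot.surjective
  have key : ∀ x, f (Function.surjInv hs (p x)) = f x := by
    intro x
    obtain ⟨g, hg⟩ := (hp.fib _ _).1 (Function.surjInv_eq hs (p x))
    conv_rhs => rw [hg, h]
  refine ⟨fun z => f (Function.surjInv hs z), ?_, key⟩
  rw [hp.quot.continuous_iff]
  convert hf using 1
  funext x; exact key x

theorem sin_sq_add_int (s : ℝ) (i : ℤ) :
    Real.sin (Real.pi * (s + i)) ^ 2 = Real.sin (Real.pi * s) ^ 2 := by
  have : Real.pi * (s + i) = Real.pi * s + i * Real.pi := by ring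
  rw [this, Real.sin_add_int_mul_pi, mul_pow]
  rcases Int.even_or_odd i with h | h <;> simp [h.neg_one_zpow]

theorem KleinCover.func (hp : KleinCover p) : ∃ F : Bool → K → ℝ, (∀ b, Continuous (F b)) ∧
    (∀ x, F false (p x) = Real.sin (Real.pi * x.1) ^ 2) ∧
    (∀ x, F true (p x) = Real.sin (Real.pi * x.2) ^ 2) := by
  obtain ⟨F, hF, hF'⟩ := hp.descend (fun x => Real.sin (Real.pi * x.1) ^ 2) (by fun_prop) (by
    intro g x; simp only [act]; exact sin_sq_add_int _ _)
  obtain ⟨G, hG, hG'⟩ := hp.descend (fun x => Real.sin (Real.pi * x.2) ^ 2) (by fun_prop) (by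
    intro g x
    simp only [act]
    rcases sg_cases g.1 with ⟨-, h⟩ | ⟨-, h⟩ <;> rw [h]
    · push_cast; rw [one_mul]; exact sin_sq_add_int _ _
    · push_cast; rw [neg_one_mul, mul_neg, Real.sin_neg, neg_sq]; exact sin_sq_add_int _ _)
  refine ⟨fun b => if b then G else F, ?_, ?_, ?_⟩
  · intro b; cases b <;> simp [hF, hG]
  · simpa using hF'
  · exact fun x => by simpa using (hG' x)

/-- centre of the interval -/
noncomputable def ctr (a : Bool) : ℝ := if a then 0 else 1 / 2

/-- The key one-variable fact. -/
theorem exists_shift (a : Bool) (s : ℝ) (h1 : a = true → Real.sin (Real.pi * s) ^ 2 < 1)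
    (h2 : a = false → 0 < Real.sin (Real.pi * s) ^ 2) :
    ∃ i : ℤ, ctr a - 1 / 2 < s + i ∧ s + i < ctr a + 1 / 2 := by
  refine ⟨- ⌊s - ctr a + 1 / 2⌋, ?_⟩
  have hle := Int.floor_le (s - ctr a + 1 / 2)
  have hlt := Int.lt_floor_add_one (s - ctr a + 1 / 2)
  set m := ⌊s - ctr a + 1 / 2⌋ with hm
  push_cast
  refine ⟨lt_of_le_of_ne (by linarith) ?_, by linarith⟩
  intro he
  have hs : s = m + (ctr a - 1 / 2) := by linarith
  cases a
  · have := h2 rfl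
    rw [hs] at this
    simp only [ctr, Bool.false_eq_true, if_false, sub_self, add_zero] at this
    rw [mul_comm, Real.sin_int_mul_pi] at this
    norm_num at this
  · have := h1 rfl
    rw [hs, add_comm, sin_sq_add_int] at this
    simp only [ctr, if_true, zero_sub] at this
    rw [show Real.pi * -(1 / 2) = -(Real.pi / 2) by ring, Real.sin_neg, Real.sin_pi_div_two] at this
    norm_num at this

/-- the rectangle -/
def rect (a b : Bool) : Set (ℝ × ℝ) :=
  Set.Ioo (ctr a - 1 / 2) (ctr a + 1 / 2) ×ˢ Set.Ioo (ctr b - 1 / 2) (ctr b + 1 / 2)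

theorem rect_inj (a b : Bool) {x : ℝ × ℝ} {g : ℤ × ℤ} (hx : x ∈ rect a b)
    (hg : act g x ∈ rect a b) : act g x = x := by
  obtain ⟨⟨h1, h2⟩, ⟨h3, h4⟩⟩ := hx
  obtain ⟨⟨h5, h6⟩, ⟨h7, h8⟩⟩ := hg
  simp only [act] at *
  have e1 : g.1 = 0 := by
    have a1 : (g.1 : ℝ) < 1 := by linarith
    have a2 : (-1 : ℝ) < g.1 := by linarith
    have a1 : g.1 < 1 := by exact_mod_cast a1
    have a2 : -1 < g.1 := by exact_mod_cast a2
    omega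
  simp only [e1, sg_zero] at *
  have e2 : g.2 = 0 := by
    push_cast at *
    have a1 : (g.2 : ℝ) < 1 := by linarith
    have a2 : (-1 : ℝ) < g.2 := by linarith
    have a1 : g.2 < 1 := by exact_mod_cast a1
    have a2 : -1 < g.2 := by exact_mod_cast a2
    omega
  simp [e2]

theorem KleinCover.inv (hp : KleinCover p) (a b : Bool) :
    ∃ q : K → ℝ × ℝ, ContinuousOn q (p '' rect a b) ∧ ∀ z ∈ p '' rect a b, p (q z) = z := by
  have hopen : IsOpenMap p := hp.qc.isOpenQuotientMap.isOpenMap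
  have hr : IsOpen (rect a b) := isOpen_Ioo.prod isOpen_Ioo
  have hinj : Set.InjOn p (rect a b) := by
    intro x hx y hy hxy
    obtain ⟨g, rfl⟩ := (hp.fib _ _).1 hxy
    exact (rect_inj a b hx hy).symm
  classical
  have hl : Set.LeftInvOn (Function.invFunOn p (rect a b)) p (rect a b) := hinj.leftInvOn_invFunOn
  refine ⟨Function.invFunOn p (rect a b), ?_, ?_⟩
  · rintro _ ⟨x, hx, rfl⟩
    apply ContinuousAt.continuousWithinAt
    intro W hW
    rw [hl hx] at hW
    have : p '' (W ∩ rect a b) ∈ 𝓝 (p x) :=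
      hopen.image_mem_nhds (Filter.inter_mem hW (hr.mem_nhds hx))
    refine Filter.mem_map.2 (Filter.mem_of_superset this ?_)
    rintro _ ⟨y, ⟨hy, hy'⟩, rfl⟩
    simp only [Set.mem_preimage]
    rw [hl hy']; exact hy
  · intro z hz
    exact Function.invFunOn_eq hz

theorem KleinCover.mem_rect (hp : KleinCover p) (F : Bool → K → ℝ)
    (hF0 : ∀ x, F false (p x) = Real.sin (Real.pi * x.1) ^ 2)
    (hF1 : ∀ x, F true (p x) = Real.sin (Real.pi * x.2) ^ 2) (a : Bool → Bool) (z : K)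
    (h1 : ∀ c, a c = true → F c z < 1) (h2 : ∀ c, a c = false → 0 < F c z) :
    z ∈ p '' rect (a false) (a true) := by
  obtain ⟨x, rfl⟩ := hp.quot.surjective z
  obtain ⟨i, hi⟩ := exists_shift (a false) x.1 (fun h => by rw [← hF0]; exact h1 _ h)
    (fun h => by rw [← hF0]; exact h2 _ h)
  set y := act (i, 0) x with hy
  have hpy : p y = p x := hp.p_act _ _
  have hF1y : F true (p y) = Real.sin (Real.pi * y.2) ^ 2 := hF1 y
  obtain ⟨k, hk⟩ := exists_shift (a true) y.2 (fun h => by rw [← hF1y, hpy]; exact h1 _ h)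
    (fun h => by rw [← hF1y, hpy]; exact h2 _ h)
  refine ⟨act (0, k) y, ⟨?_, ?_⟩, by rw [hp.p_act, hpy]⟩
  · simpa [hy, act] using hi
  · simpa [act, sg_zero] using hk

/-- existence of a section on an open set -/
def HasSec {n : ℕ} (τ : Fin n → I) (W : Set (Fin n → K)) : Prop :=
  ∃ s : (Fin n → K) → C(I, K), ContinuousOn s W ∧ ∀ u ∈ W, ∀ j, s u (τ j) = u j

theorem KleinCover.hasSec (hp : KleinCover p) {n : ℕ} (τ : Fin n → I)
    (lam : Fin n → C(I, ℝ)) (hlam : ∀ i j, lam i (τ j) = if i = j then 1 else 0)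
    (a : Fin n → Bool → Bool) (W : Set (Fin n → K))
    (hW : ∀ u ∈ W, ∀ j, u j ∈ p '' rect (a j false) (a j true)) : HasSec τ W := by
  classical
  have hpc : Continuous p := hp.quot.continuous
  choose q hq1 hq2 using fun j => hp.inv (a j false) (a j true)
  have hqc : ∀ j, Continuous (fun u : W => q j (u.1 j)) := by
    intro j
    exact (hq1 j).comp_continuous ((continuous_apply j).comp continuous_subtype_val)
      (fun u => hW _ u.2 j)
  let f : C(W × I, K) := ⟨fun z => p (∑ j, lam j z.2 • q j (z.1.1 j)), by
    have h1 : ∀ j, Continuous (fun z : W × I => q j (z.1.1 j)) := fun j =>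
      (hqc j).comp continuous_fst
    have h2 : ∀ j, Continuous (fun z : W × I => lam j z.2) := fun j => by fun_prop
    refine hpc.comp (continuous_finsetSum _ fun j _ => ?_)
    exact (h2 j).smul (h1 j)⟩
  refine ⟨fun u => if h : u ∈ W then f.curry ⟨u, h⟩ else ContinuousMap.const I (p 0), ?_, ?_⟩
  · rw [continuousOn_iff_continuous_domRestrict]
    convert f.curry.continuous using 1
    funext u
    simp
  · intro u hu j
    simp only [dif_pos hu, ContinuousMap.curry_apply, f, ContinuousMap.coe_mk, hlam]
    simp [hq2 j _ (hW u hu j)]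

theorem hasSec_iUnion {n : ℕ} {τ : Fin n → I} {ω : Type*} (W : ω → Set (Fin n → K))
    (P : ω → Prop)
    (hW : ∀ i, IsOpen (W i)) (hd : ∀ i j u, P i → P j → u ∈ W i → u ∈ W j → i = j)
    (hs : ∀ i, HasSec τ (W i)) [Nonempty (C(I, K))] :
    HasSec τ {u | ∃ i, P i ∧ u ∈ W i} := by
  classical
  choose s hs1 hs2 using hs
  have key : ∀ i u, P i → u ∈ W i →
      (if h : ∃ i, P i ∧ u ∈ W i then s h.choose u else Classical.arbitrary _) = s i u := by
    intro i u hi hu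
    have h : ∃ i, P i ∧ u ∈ W i := ⟨i, hi, hu⟩
    rw [dif_pos h, hd _ _ u h.choose_spec.1 hi h.choose_spec.2 hu]
  refine ⟨fun u => if h : ∃ i, P i ∧ u ∈ W i then s h.choose u else Classical.arbitrary _, ?_, ?_⟩
  · rintro u ⟨i, hi, hu⟩
    apply ContinuousAt.continuousWithinAt
    refine ((hs1 i).continuousAt ((hW i).mem_nhds hu)).congr ?_
    filter_upwards [(hW i).mem_nhds hu] with v hv
    exact (key i v hi hv).symm
  · rintro u ⟨i, hi, hu⟩ j
    beta_reduce
    rw [key i u hi hu]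
    exact hs2 i u hu j

theorem KleinCover.upper (hp : KleinCover p) {n : ℕ} (τ : Fin n → I)
    (lam : Fin n → C(I, ℝ)) (hlam : ∀ i j, lam i (τ j) = if i = j then 1 else 0) :
    ∃ U : Fin (2 * n + 1) → Set (Fin n → K), (∀ i, IsOpen (U i)) ∧ (⋃ i, U i) = Set.univ ∧
      ∀ i, HasSec τ (U i) := by
  classical
  obtain ⟨F, hF, hF0, hF1⟩ := hp.func
  have : Nonempty (C(I, K)) := ⟨ContinuousMap.const I (p 0)⟩
  let D : Fin n × Bool → (Fin n → K) → ℝ := fun c u => F c.2 (u c.1)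
  have hD : ∀ c, Continuous (D c) := fun c => (hF c.2).comp (continuous_apply c.1)
  let W : Finset (Fin n × Bool) → Set (Fin n → K) := fun S =>
    (⋂ c ∈ S, {u | D c u < 1}) ∩ (⋂ c ∈ Sᶜ, {u | 0 < D c u}) ∩
      ⋂ c ∈ S, ⋂ d ∈ Sᶜ, {u | D c u < D d u}
  have hWm : ∀ S u, u ∈ W S ↔ ((∀ c ∈ S, D c u < 1) ∧ (∀ c ∉ S, 0 < D c u)) ∧
      ∀ c ∈ S, ∀ d ∉ S, D c u < D d u := by
    intro S u
    simp [W]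
  have hWo : ∀ S, IsOpen (W S) := by
    intro S
    refine IsOpen.inter (IsOpen.inter ?_ ?_) ?_
    · exact isOpen_biInter_finset fun c _ => isOpen_lt (hD c) continuous_const
    · exact isOpen_biInter_finset fun c _ => isOpen_lt continuous_const (hD c)
    · exact isOpen_biInter_finset fun c _ => isOpen_biInter_finset fun d _ =>
        isOpen_lt (hD c) (hD d)
  have hWs : ∀ S, HasSec τ (W S) := by
    intro S
    refine hp.hasSec τ lam hlam (fun j b => decide ((j, b) ∈ S)) (W S) ?_
    intro u hu j
    rw [hWm] at hu
    refine hp.mem_rect F hF0 hF1 (fun b => decide ((j, b) ∈ S)) (u j) ?_ ?_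
    · intro c hc
      exact hu.1.1 (j, c) (by simpa using hc)
    · intro c hc
      exact hu.1.2 (j, c) (by simpa using hc)
  refine ⟨fun k => {u | ∃ S : Finset (Fin n × Bool), S.card = (k : ℕ) ∧ u ∈ W S}, ?_, ?_, ?_⟩
  · intro k
    have : {u | ∃ S : Finset (Fin n × Bool), S.card = (k : ℕ) ∧ u ∈ W S} =
        ⋃ S : Finset (Fin n × Bool), ⋃ _ : S.card = (k : ℕ), W S := by
      ext u; simp
    change IsOpen {u | ∃ S : Finset (Fin n × Bool), S.card = (k : ℕ) ∧ u ∈ W S}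
    rw [this]
    exact isOpen_iUnion fun S => isOpen_iUnion fun _ => hWo S
  · rw [Set.eq_univ_iff_forall]
    intro u
    have hcard : (Finset.univ.filter fun c => D c u < 1 / 2).card < 2 * n + 1 := by
      have := Finset.card_le_univ (Finset.univ.filter fun c => D c u < 1 / 2)
      simp at this
      simp; omega
    refine Set.mem_iUnion.2 ⟨⟨_, hcard⟩, Finset.univ.filter fun c => D c u < 1 / 2, rfl, ?_⟩
    rw [hWm]
    simp only [Finset.mem_filter, Finset.mem_univ, true_and, not_lt]
    exact ⟨⟨fun c h => by linarith, fun c h => by linarith⟩, fun c h d h' => by linarith⟩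
  · intro k
    refine hasSec_iUnion W (fun S => S.card = (k : ℕ)) hWo ?_ hWs
    intro S T u hS hT huS huT
    by_contra hne
    rw [hWm] at huS huT
    have h1 : ¬ S ⊆ T := fun h => hne (Finset.eq_of_subset_of_card_le h (by omega))
    have h2 : ¬ T ⊆ S := fun h => hne (Finset.eq_of_subset_of_card_le h (by omega)).symm
    obtain ⟨c, hc, hc'⟩ := Finset.not_subset.1 h1
    obtain ⟨d, hd, hd'⟩ := Finset.not_subset.1 h2
    have a1 := huS.2 c hc d hd'
    have a2 := huT.2 d hd c hc'
    linarith

end upper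
end KleinTC

namespace KleinTC
open Topology
open scoped unitInterval

section proj
variable {m : ℕ}

theorem isQuotientMap_mk : IsQuotientMap
    (fun v : {v : Fin m → ℝ // v ≠ 0} => Projectivization.mk ℝ v.1 v.2) :=
  by exact isQuotientMap_quotient_mk' (s := projectivizationSetoid ℝ (Fin m → ℝ))

/-- the embedding into matrices -/
noncomputable def vero (v : Fin m → ℝ) : Fin m → Fin m → ℝ :=
  fun i j => v i * v j / ∑ k, v k ^ 2

theorem sum_sq_pos {v : Fin m → ℝ} (hv : v ≠ 0) : 0 < ∑ k, v k ^ 2 := by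
  obtain ⟨i, hi⟩ := Function.ne_iff.1 hv
  exact Finset.sum_pos' (fun k _ => sq_nonneg _) ⟨i, Finset.mem_univ _, by
    have hi' : v i ≠ 0 := hi
    positivity⟩

theorem vero_smul {v : Fin m → ℝ} {a : ℝ} (ha : a ≠ 0) : vero (a • v) = vero v := by
  funext i j
  simp only [vero, Pi.smul_apply, smul_eq_mul, mul_pow, ← Finset.mul_sum]
  rw [show a * v i * (a * v j) = a ^ 2 * (v i * v j) by ring]
  exact mul_div_mul_left _ _ (by positivity)

theorem vero_rep {v : Fin m → ℝ} (hv : v ≠ 0) :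
    vero (Projectivization.mk ℝ v hv).rep = vero v := by
  obtain ⟨a, ha⟩ := Projectivization.exists_smul_eq_mk_rep ℝ v hv
  rw [← ha]
  exact vero_smul a.ne_zero

instance t2_proj : T2Space (Projectivization ℝ (Fin m → ℝ)) := by
  refine T2Space.of_injective_continuous (f := fun P => vero P.rep) ?_ ?_
  · intro P Q hPQ
    induction P using Projectivization.ind with | _ v hv =>
    induction Q using Projectivization.ind with | _ w hw =>
    simp only [vero_rep] at hPQ
    obtain ⟨i, hi⟩ := Function.ne_iff.1 hw
    simp only [Pi.zero_apply] at hi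
    have hsv := sum_sq_pos hv
    have hsw := sum_sq_pos hw
    have h : ∀ j, v i * v j / (∑ k, v k ^ 2) = w i * w j / ∑ k, w k ^ 2 :=
      fun j => congrFun (congrFun hPQ i) j
    set A := ∑ k, v k ^ 2
    set B := ∑ k, w k ^ 2
    rw [Projectivization.mk_eq_mk_iff']
    have h' : ∀ j, v i * v j * B = w i * w j * A := fun j => by
      have := h j
      rwa [div_eq_div_iff hsv.ne' hsw.ne'] at this
    have hvi : v i ≠ 0 := by
      intro h0
      have h1 := h' i
      rw [h0] at h1
      have : w i * w i * A ≠ 0 := by positivity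
      exact this (by linarith)
    refine ⟨v i / w i, ?_⟩
    funext j
    simp only [Pi.smul_apply, smul_eq_mul]
    rw [div_mul_eq_mul_div, div_eq_iff hi]
    apply mul_left_cancel₀ (mul_ne_zero hvi hsw.ne')
    linear_combination w j * h' i - w i * h' j
  · rw [isQuotientMap_mk.continuous_iff]
    have : (fun P : Projectivization ℝ (Fin m → ℝ) => vero P.rep) ∘
        (fun v : {v : Fin m → ℝ // v ≠ 0} => Projectivization.mk ℝ v.1 v.2) =
        fun v => vero v.1 := by
      funext v; exact vero_rep v.2
    rw [this]
    refine continuous_pi fun i => continuous_pi fun j => ?_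
    have hc : ∀ i, Continuous (fun v : {v : Fin m → ℝ // v ≠ 0} => v.1 i) := fun i =>
      (continuous_apply i).comp continuous_subtype_val
    refine Continuous.div ?_ ?_ ?_
    · exact (hc i).mul (hc j)
    · exact continuous_finsetSum _ fun k _ => (hc k).pow 2
    · intro v; exact (sum_sq_pos v.2).ne'

end proj

theorem mem_milnor (x : Fin 3 → ℝ) (y : Fin 2 → ℝ) (hx : x ≠ 0) (hy : y ≠ 0) :
    ((Projectivization.mk ℝ x hx, Projectivization.mk ℝ y hy) ∈ RealMilnor 2 1) ↔
      x 0 * y 0 + x 1 * y 1 = 0 := by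
  obtain ⟨a, ha⟩ := Projectivization.exists_smul_eq_mk_rep ℝ x hx
  obtain ⟨b, hb⟩ := Projectivization.exists_smul_eq_mk_rep ℝ y hy
  have : ((Projectivization.mk ℝ x hx, Projectivization.mk ℝ y hy) ∈ RealMilnor 2 1) ↔
      (Projectivization.mk ℝ x hx).rep 0 * (Projectivization.mk ℝ y hy).rep 0 +
      (Projectivization.mk ℝ x hx).rep 1 * (Projectivization.mk ℝ y hy).rep 1 = 0 := by
    change (∑ i : Fin 2, _ = (0 : ℝ)) ↔ _
    rw [Fin.sum_univ_two]
    rfl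
  rw [this, ← ha, ← hb]
  have ha0 : (a : ℝ) ≠ 0 := a.ne_zero
  have hb0 : (b : ℝ) ≠ 0 := b.ne_zero
  have : (a • x) 0 * (b • y) 0 + (a • x) 1 * (b • y) 1 =
      ((a : ℝ) * b) * (x 0 * y 0 + x 1 * y 1) := by
    simp only [Pi.smul_apply, Units.smul_def, smul_eq_mul]; ring
  rw [this, mul_eq_zero]
  simp [ha0, hb0]

open Real in
/-- first vector -/
noncomputable def vx (z : ℝ × ℝ) : Fin 3 → ℝ :=
  ![- (sin (π * z.1) * cos (π * z.2)), cos (π * z.1) * cos (π * z.2), sin (π * z.2)]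

open Real in
/-- second vector -/
noncomputable def vy (z : ℝ × ℝ) : Fin 2 → ℝ := ![cos (π * z.1), sin (π * z.1)]

theorem cos_sin_ne (t : ℝ) (h1 : Real.cos t = 0) (h2 : Real.sin t = 0) : False := by
  have := Real.sin_sq_add_cos_sq t
  rw [h1, h2] at this; norm_num at this

theorem vy_ne (z : ℝ × ℝ) : vy z ≠ 0 := by
  intro h
  exact cos_sin_ne _ (congrFun h 0) (congrFun h 1)

theorem vx_ne (z : ℝ × ℝ) : vx z ≠ 0 := by
  intro h
  have h0 : - (Real.sin (Real.pi * z.1) * Real.cos (Real.pi * z.2)) = 0 := congrFun h 0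
  have h1 : Real.cos (Real.pi * z.1) * Real.cos (Real.pi * z.2) = 0 := congrFun h 1
  have h2 : Real.sin (Real.pi * z.2) = 0 := congrFun h 2
  refine cos_sin_ne (Real.pi * z.2) ?_ h2
  have := Real.sin_sq_add_cos_sq (Real.pi * z.1)
  linear_combination (-Real.cos (Real.pi * z.2)) * this - Real.sin (Real.pi * z.1) * h0 +
    Real.cos (Real.pi * z.1) * h1

/-- the covering map -/
noncomputable def pc (z : ℝ × ℝ) : ↥(RealMilnor 2 1) :=
  ⟨(Projectivization.mk ℝ (vx z) (vx_ne z), Projectivization.mk ℝ (vy z) (vy_ne z)), by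
    rw [mem_milnor]; simp [vx, vy]; ring⟩

theorem pc_continuous : Continuous pc := by
  have hx : Continuous vx := by
    unfold vx
    refine continuous_pi fun i => ?_
    fin_cases i <;> simp <;> fun_prop
  have hy : Continuous vy := by
    unfold vy
    refine continuous_pi fun i => ?_
    fin_cases i <;> simp <;> fun_prop
  refine Continuous.subtype_mk ?_ _
  refine Continuous.prodMk ?_ ?_
  · exact isQuotientMap_mk.continuous.comp (Continuous.subtype_mk hx vx_ne)
  · exact isQuotientMap_mk.continuous.comp (Continuous.subtype_mk hy vy_ne)

theorem pc_eq_iff (z w : ℝ × ℝ) : pc z = pc w ↔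
    (∃ a : ℝ, a • vx w = vx z) ∧ (∃ a : ℝ, a • vy w = vy z) := by
  simp only [pc, Subtype.mk.injEq, Prod.mk.injEq, Projectivization.mk_eq_mk_iff']

theorem sin_add_int (s : ℝ) (i : ℤ) :
    Real.sin (Real.pi * (s + i)) = sg i * Real.sin (Real.pi * s) := by
  have : Real.pi * (s + i) = Real.pi * s + i * Real.pi := by ring
  rw [this, Real.sin_add_int_mul_pi]
  rcases sg_cases i with ⟨h, h'⟩ | ⟨h, h'⟩ <;> rw [h']
  · rw [(Int.even_iff.2 h).neg_one_zpow]; simp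
  · rw [(Int.odd_iff.2 h).neg_one_zpow]; simp

theorem cos_add_int (s : ℝ) (i : ℤ) :
    Real.cos (Real.pi * (s + i)) = sg i * Real.cos (Real.pi * s) := by
  have : Real.pi * (s + i) = Real.pi * s + i * Real.pi := by ring
  rw [this, Real.cos_add_int_mul_pi]
  rcases sg_cases i with ⟨h, h'⟩ | ⟨h, h'⟩ <;> rw [h']
  · rw [(Int.even_iff.2 h).neg_one_zpow]; simp
  · rw [(Int.odd_iff.2 h).neg_one_zpow]; simp

theorem sin_sg (i : ℤ) (s : ℝ) : Real.sin (Real.pi * (sg i * s)) = sg i * Real.sin (Real.pi * s) := by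
  rcases sg_cases i with ⟨h, h'⟩ | ⟨h, h'⟩ <;> rw [h'] <;> simp

theorem cos_sg (i : ℤ) (s : ℝ) : Real.cos (Real.pi * (sg i * s)) = Real.cos (Real.pi * s) := by
  rcases sg_cases i with ⟨h, h'⟩ | ⟨h, h'⟩ <;> rw [h'] <;> simp

theorem pc_act (g : ℤ × ℤ) (z : ℝ × ℝ) : pc (act g z) = pc z := by
  rw [pc_eq_iff]
  refine ⟨⟨sg g.1 * sg g.2, ?_⟩, ⟨sg g.1, ?_⟩⟩
  · funext i
    fin_cases i
    · simp [vx, act, sin_add_int, cos_add_int, cos_sg]; ring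
    · simp [vx, act, sin_add_int, cos_add_int, cos_sg]; ring
    · simp [vx, act, sin_add_int, sin_sg]; ring
  · funext i
    fin_cases i
    · simp [vy, act, cos_add_int]
    · simp [vy, act, sin_add_int]

theorem angle_eq {s t a : ℝ} (h1 : a * Real.cos (Real.pi * t) = Real.cos (Real.pi * s))
    (h2 : a * Real.sin (Real.pi * t) = Real.sin (Real.pi * s)) : ∃ i : ℤ, s = t + i := by
  have : Real.sin (Real.pi * s - Real.pi * t) = 0 := by
    rw [Real.sin_sub, ← h1, ← h2]; ring
  obtain ⟨i, hi⟩ := Real.sin_eq_zero_iff.1 this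
  refine ⟨i, ?_⟩
  have hpi := Real.pi_ne_zero
  apply mul_left_cancel₀ hpi
  linarith

theorem pc_fib (z w : ℝ × ℝ) : pc z = pc w ↔ ∃ g, w = act g z := by
  constructor
  · intro h
    obtain ⟨-, a, ha⟩ := (pc_eq_iff w z).1 h.symm
    obtain ⟨i, hi⟩ := angle_eq (congrFun ha 0) (congrFun ha 1)
    set u := act (i, 0) z with hu
    have h' : pc w = pc u := by rw [hu, pc_act, h]
    have h1 : w.1 = u.1 := hi
    obtain ⟨⟨b, hb⟩, -⟩ := (pc_eq_iff w u).1 h'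
    have e0 : b * -(Real.sin (Real.pi * u.1) * Real.cos (Real.pi * u.2)) =
      -(Real.sin (Real.pi * w.1) * Real.cos (Real.pi * w.2)) := congrFun hb 0
    have e1 : b * (Real.cos (Real.pi * u.1) * Real.cos (Real.pi * u.2)) =
      Real.cos (Real.pi * w.1) * Real.cos (Real.pi * w.2) := congrFun hb 1
    have e2 : b * Real.sin (Real.pi * u.2) = Real.sin (Real.pi * w.2) := congrFun hb 2
    rw [← h1] at e0 e1
    have e3 : b * Real.cos (Real.pi * u.2) = Real.cos (Real.pi * w.2) := by
      have := Real.sin_sq_add_cos_sq (Real.pi * w.1)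
      linear_combination (Real.cos (Real.pi * w.2) - b * Real.cos (Real.pi * u.2)) * this -
        Real.sin (Real.pi * w.1) * e0 + Real.cos (Real.pi * w.1) * e1
    obtain ⟨k, hk⟩ := angle_eq e3 e2
    refine ⟨gmul (0, k) (i, 0), ?_⟩
    rw [← act_act, ← hu]
    ext
    · simp [act, h1]
    · simp [act, hk, sg_zero]
  · rintro ⟨g, rfl⟩
    exact (pc_act g z).symm

theorem polar (a b : ℝ) : ∃ r t : ℝ, a = r * Real.cos (Real.pi * t) ∧
    b = r * Real.sin (Real.pi * t) := by
  refine ⟨‖(⟨a, b⟩ : ℂ)‖, Complex.arg ⟨a, b⟩ / Real.pi, ?_, ?_⟩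
  · rw [mul_div_cancel₀ _ Real.pi_ne_zero, Complex.norm_mul_cos_arg]
  · rw [mul_div_cancel₀ _ Real.pi_ne_zero, Complex.norm_mul_sin_arg]

theorem pc_surj : Function.Surjective pc := by
  rintro ⟨⟨P, Q⟩, hPQ⟩
  induction P using Projectivization.ind with | _ x hx =>
  induction Q using Projectivization.ind with | _ y hy =>
  rw [mem_milnor] at hPQ
  obtain ⟨r, s, h0, h1⟩ := polar (y 0) (y 1)
  have hr : r ≠ 0 := by
    rintro rfl
    apply hy
    funext i; fin_cases i
    · simpa using h0
    · simpa using h1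
  have hsc := Real.sin_sq_add_cos_sq (Real.pi * s)
  have hort : x 0 * Real.cos (Real.pi * s) + x 1 * Real.sin (Real.pi * s) = 0 := by
    rw [h0, h1] at hPQ
    apply mul_left_cancel₀ hr
    linear_combination hPQ
  obtain ⟨q, t, h2, h3⟩ := polar (x 1 * Real.cos (Real.pi * s) - x 0 * Real.sin (Real.pi * s)) (x 2)
  have hx0 : x 0 = q * -(Real.sin (Real.pi * s) * Real.cos (Real.pi * t)) := by
    linear_combination (-x 0) * hsc + Real.cos (Real.pi * s) * hort - Real.sin (Real.pi * s) * h2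
  have hx1 : x 1 = q * (Real.cos (Real.pi * s) * Real.cos (Real.pi * t)) := by
    linear_combination (-x 1) * hsc + Real.sin (Real.pi * s) * hort + Real.cos (Real.pi * s) * h2
  have hq : q ≠ 0 := by
    rintro rfl
    apply hx
    funext i; fin_cases i
    · simpa using hx0
    · simpa using hx1
    · simpa using h3
  refine ⟨(s, t), ?_⟩
  simp only [pc, Subtype.mk.injEq, Prod.mk.injEq, Projectivization.mk_eq_mk_iff']
  refine ⟨⟨q⁻¹, ?_⟩, ⟨r⁻¹, ?_⟩⟩
  · rw [inv_smul_eq_iff₀ hq]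
    funext i; fin_cases i
    · exact hx0
    · exact hx1
    · exact h3
  · rw [inv_smul_eq_iff₀ hr]
    funext i; fin_cases i
    · exact h0
    · exact h1

theorem pc_cover : KleinCover pc where
  fib := pc_fib
  quot := by
    let B : Set (ℝ × ℝ) := Set.Icc (0, 0) (1, 1)
    have hB : IsCompact B := isCompact_Icc
    have : CompactSpace B := isCompact_iff_compactSpace.1 hB
    have hc : Continuous (pc ∘ (Subtype.val : B → ℝ × ℝ)) :=
      pc_continuous.comp continuous_subtype_val
    refine IsQuotientMap.of_comp continuous_subtype_val pc_continuous
      (hc.isClosedMap.isQuotientMap hc ?_)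
    intro P
    obtain ⟨z, rfl⟩ := pc_surj P
    set u := act (-⌊z.1⌋, 0) z with hu
    have h1 : 0 ≤ u.1 ∧ u.1 ≤ 1 := by
      simp only [hu, act]
      have := Int.floor_le z.1
      have := Int.lt_floor_add_one z.1
      push_cast
      constructor <;> linarith
    have h2 : 0 ≤ u.2 + -⌊u.2⌋ ∧ u.2 + -⌊u.2⌋ ≤ 1 := by
      have := Int.floor_le u.2
      have := Int.lt_floor_add_one u.2
      constructor <;> linarith
    refine ⟨⟨act (0, -⌊u.2⌋) u, ?_⟩, ?_⟩
    · simp only [act, sg_zero]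
      refine ⟨⟨?_, ?_⟩, ⟨?_, ?_⟩⟩ <;> simp [h1.1, h1.2] <;> linarith [h2.1, h2.2]
    · simp only [Function.comp]
      rw [pc_act, hu, pc_act]

end KleinTC

namespace KleinTC
open Topology
open scoped unitInterval

theorem exists_cover (K : Type*) [TopologicalSpace K] (hK : Nonempty (K ≃ₜ ↥(RealMilnor 2 1))) :
    ∃ p : ℝ × ℝ → K, KleinCover p := by
  obtain ⟨φ⟩ := hK
  refine ⟨φ.symm ∘ pc, ⟨φ.symm.isQuotientMap.comp pc_cover.quot, ?_⟩⟩
  intro x y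
  simp [pc_fib]

/-- the sampling times -/
noncomputable def tau (n : ℕ) (i : Fin n) : I :=
  Set.projIcc (0 : ℝ) 1 zero_le_one ((i : ℝ) / ((n : ℝ) - 1))

theorem tau_val {n : ℕ} (hn : 2 ≤ n) (i : Fin n) :
    ((tau n i : I) : ℝ) = (i : ℝ) / ((n : ℝ) - 1) := by
  have hn' : (2 : ℝ) ≤ n := by exact_mod_cast hn
  have hi : (i : ℝ) + 1 ≤ n := by exact_mod_cast i.2
  have h0 : (0 : ℝ) ≤ i := by positivity
  have : (i : ℝ) / ((n : ℝ) - 1) ∈ Set.Icc (0 : ℝ) 1 := by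
    refine ⟨div_nonneg h0 (by linarith), ?_⟩
    rw [div_le_one (by linarith)]; linarith
  rw [tau, Set.projIcc_of_mem _ this]

/-- the bump functions -/
noncomputable def bump (n : ℕ) (i : Fin n) : C(I, ℝ) :=
  ⟨fun t => max 0 (1 - |(t : ℝ) * ((n : ℝ) - 1) - i|), by fun_prop⟩

theorem bump_tau {n : ℕ} (hn : 2 ≤ n) (i j : Fin n) :
    bump n i (tau n j) = if i = j then 1 else 0 := by
  have hn' : (2 : ℝ) ≤ n := by exact_mod_cast hn
  simp only [bump, ContinuousMap.coe_mk, tau_val hn]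
  rw [div_mul_cancel₀ _ (by linarith)]
  split_ifs with h
  · simp [h]
  · apply max_eq_left
    have h1 : ((j : ℕ) : ℤ) - ((i : ℕ) : ℤ) ≠ 0 := by
      intro h'
      apply h
      ext; omega
    have h2 : (1 : ℝ) ≤ |(j : ℝ) - i| := by
      have := Int.one_le_abs h1
      exact_mod_cast this
    linarith

theorem main (K : Type*) [TopologicalSpace K]
    (hK : Nonempty (K ≃ₜ ↥(RealMilnor 2 1))) (n : ℕ) (hn : 2 ≤ n) :
    higherTC K n = 2 * n + 1 := by
  obtain ⟨p, hp⟩ := exists_cover K hK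
  apply le_antisymm
  · apply Nat.sInf_le
    refine ⟨by omega, ?_⟩
    obtain ⟨U, h1, h2, h3⟩ := hp.upper (tau n) (bump n) (bump_tau hn)
    refine ⟨U, h1, h2, fun i => ?_⟩
    obtain ⟨s, hs, hs'⟩ := h3 i
    refine ⟨⟨fun u => s u.1, continuousOn_iff_continuous_domRestrict.1 hs⟩, ?_⟩
    intro u
    funext j
    exact hs' u.1 u.2 j
  · apply le_csInf
    · obtain ⟨U, h1, h2, h3⟩ := hp.upper (tau n) (bump n) (bump_tau hn)
      refine ⟨2 * n + 1, by omega, U, h1, h2, fun i => ?_⟩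
      obtain ⟨s, hs, hs'⟩ := h3 i
      refine ⟨⟨fun u => s u.1, continuousOn_iff_continuous_domRestrict.1 hs⟩, ?_⟩
      intro u
      funext j
      exact hs' u.1 u.2 j
    · rintro k ⟨-, U, h1, h2, h3⟩
      refine lower hp hn (tau n) ?_ k U h1 h2 ?_
      · intro j hj
        apply Subtype.ext
        rw [tau_val hn, hj]; simp
      · intro i
        obtain ⟨sec, hsec⟩ := h3 i
        exact ⟨sec, fun u j => congrFun (hsec u) j⟩

end KleinTC

/-- The `n`-th higher topological complexity of the Klein bottle (which is
homeomorphic to the real Milnor manifold `ℝH_{2,1}`) equals `2n + 1` for every `n ≥ 2`. -/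
theorem higherTC_kleinBottle (K : Type*) [TopologicalSpace K]
    (hK : Nonempty (K ≃ₜ ↥(RealMilnor 2 1))) (n : ℕ) (hn : 2 ≤ n) :
    higherTC K n = 2 * n + 1 := by
  exact KleinTC.main K hK n hn
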